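/- Propagation of eigenvalues of high geometric multiplicity. Let (g, L) be a compatible pair on a connected open set U ⊆ ℝ^n, let V ⊆ U be a nonempty connected open subset, and let λ : V → ℂ be continuous with either λ(x) ∈ ℝ for all x ∈ V or Im λ(x) ≠ 0 for all x ∈ V. Assume that for every x ∈ V, λ(x) is an eigenvalue of L(x) with dim_ℂ ker(L(x) − λ(x)·I) ≥ 2 (kernel in ℂ^n). Then λ is constant on V, say λ ≡ c, and moreover for every x ∈ U the number c is an eigenvalue of L(x) with dim_ℂ ker(L(x) − c·I) ≥ 2. -/

import Mathlib

open Matrix Polynomial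

noncomputable def pd {ι : Type*} [Fintype ι] [DecidableEq ι] (i : ι)
    (f : (ι → ℝ) → ℝ) (x : ι → ℝ) : ℝ :=
  fderiv ℝ f x (Pi.single i 1)

noncomputable def christoffel {ι : Type*} [Fintype ι] [DecidableEq ι]
    (g : (ι → ℝ) → Matrix ι ι ℝ) (x : ι → ℝ) (l j k : ι) : ℝ :=
  (1/2) * ∑ m, (g x)⁻¹ l m *
    (pd j (fun y => g y m k) x + pd k (fun y => g y m j) x - pd m (fun y => g y j k) x)

def IsCompatiblePair {ι : Type*} [Fintype ι] [DecidableEq ι]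
    (U : Set (ι → ℝ)) (g L : (ι → ℝ) → Matrix ι ι ℝ) : Prop :=
  (∀ i j : ι, ContDiffOn ℝ (⊤ : ℕ∞) (fun y => g y i j) U) ∧
  (∀ i j : ι, ContDiffOn ℝ (⊤ : ℕ∞) (fun y => L y i j) U) ∧
  (∀ x ∈ U, (g x).IsSymm ∧ IsUnit (g x).det ∧ IsUnit (L x).det ∧ (g x * L x).IsSymm) ∧
  (∀ x ∈ U, ∀ i j k : ι,
    pd k (fun y => (g y * L y) i j) x
      - (∑ l, christoffel g x l k i * (g x * L x) l j)
      - (∑ l, christoffel g x l k j * (g x * L x) i l)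
    = pd i (fun y => (1/2) * (L y).trace) x * g x j k
      + pd j (fun y => (1/2) * (L y).trace) x * g x i k)

set_option linter.unusedSectionVars false


theorem adj_zero_of_ker {n : ℕ} (A : Matrix (Fin n) (Fin n) ℂ)
    (h : 2 ≤ Module.finrank ℂ (LinearMap.ker (Matrix.mulVecLin A))) : A.adjugate = 0 := by
  by_contra hne
  have : ∃ i j, A.adjugate i j ≠ 0 := by
    by_contra hh
    push Not at hh
    exact hne (by ext i j; simp [hh])
  obtain ⟨i, j, hij⟩ := this
  rw [Matrix.adjugate_apply] at hij
  let φ : LinearMap.ker (Matrix.mulVecLin A) →ₗ[ℂ] ℂ :=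
    (LinearMap.proj i).comp (Submodule.subtype _)
  have hinj : Function.Injective φ := by
    rw [injective_iff_map_eq_zero]
    rintro ⟨v, hv⟩ hv0
    have hvi : v i = 0 := hv0
    have hAv : A *ᵥ v = 0 := by simpa using hv
    have hz : (A.updateRow j (Pi.single i 1)) *ᵥ v = 0 := by
      ext l
      by_cases hl : l = j
      · subst hl
        simp [Matrix.mulVec, hvi]
      · have := congrFun hAv l
        simp only [Matrix.mulVec, Pi.zero_apply] at this ⊢
        rw [Matrix.updateRow_ne hl]
        exact this
    have := Matrix.eq_zero_of_mulVec_eq_zero hij hz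
    exact Subtype.ext this
  have := LinearMap.finrank_le_finrank_of_injective hinj
  simp at this
  omega

theorem ker_of_adj_zero {n : ℕ} (hn : 0 < n) (A : Matrix (Fin n) (Fin n) ℂ)
    (h : A.adjugate = 0) : 2 ≤ Module.finrank ℂ (LinearMap.ker (Matrix.mulVecLin A)) := by
  have : Nonempty (Fin n) := ⟨⟨0, hn⟩⟩
  by_contra hlt
  push Not at hlt
  have hdet : A.det = 0 := by
    have h1 := A.mul_adjugate
    rw [h, Matrix.mul_zero] at h1
    have := congrFun (congrFun h1 ⟨0, hn⟩) ⟨0, hn⟩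
    simpa using this.symm
  obtain ⟨v, hv0, hv⟩ := Matrix.exists_mulVec_eq_zero_iff.mpr hdet
  obtain ⟨u, hu0, hu⟩ := Matrix.exists_vecMul_eq_zero_iff.mpr hdet
  obtain ⟨i, hi⟩ := Function.ne_iff.mp hv0
  obtain ⟨j, hj⟩ := Function.ne_iff.mp hu0
  simp only [Pi.zero_apply] at hi hj
  have hadj : A.adjugate i j = 0 := by simp [h]
  rw [Matrix.adjugate_apply] at hadj
  obtain ⟨x, hx0, hx⟩ := Matrix.exists_mulVec_eq_zero_iff.mpr hadj
  have hxi : x i = 0 := by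
    have := congrFun hx j
    simpa [Matrix.mulVec] using this
  have hAl : ∀ l, l ≠ j → (A *ᵥ x) l = 0 := by
    intro l hl
    have := congrFun hx l
    simp only [Matrix.mulVec, Pi.zero_apply] at this ⊢
    rwa [Matrix.updateRow_ne hl] at this
  have hAj : (A *ᵥ x) j = 0 := by
    have h1 : u ⬝ᵥ (A *ᵥ x) = 0 := by rw [Matrix.dotProduct_mulVec, hu]; simp
    rw [dotProduct, Finset.sum_eq_single j] at h1
    · simpa [hj] using h1
    · intro l _ hl; rw [hAl l hl, mul_zero]
    · simp
  have hAx : A *ᵥ x = 0 := by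
    ext l
    by_cases hl : l = j
    · subst hl; exact hAj
    · exact hAl l hl
  have hle : Module.finrank ℂ (LinearMap.ker (Matrix.mulVecLin A)) ≤ 1 := by omega
  rw [finrank_le_one_iff] at hle
  obtain ⟨w, hw⟩ := hle
  obtain ⟨a, ha⟩ := hw ⟨v, by simpa using hv⟩
  obtain ⟨b, hb⟩ := hw ⟨x, by simpa using hAx⟩
  have ha' : a • (w : Fin n → ℂ) = v := by simpa using congrArg Subtype.val ha
  have hb' : b • (w : Fin n → ℂ) = x := by simpa using congrArg Subtype.val hb
  have hwi : (w : Fin n → ℂ) i ≠ 0 := by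
    intro h0
    apply hi
    rw [← ha']; simp [h0]
  have hb0 : b = 0 := by
    have := congrFun hb' i
    rw [hxi] at this
    simpa [hwi] using this
  apply hx0
  rw [← hb', hb0, zero_smul]

theorem mem_spec_of_ker {n : ℕ} (A : Matrix (Fin n) (Fin n) ℂ) (c : ℂ)
    (h : 2 ≤ Module.finrank ℂ (LinearMap.ker (Matrix.mulVecLin (A - c • 1)))) :
    c ∈ spectrum ℂ A := by
  rw [spectrum.mem_iff]
  intro hu
  have hu' : IsUnit (A - c • (1 : Matrix (Fin n) (Fin n) ℂ)) := by
    have := hu.neg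
    rwa [neg_sub, Algebra.algebraMap_eq_smul_one] at this
  have hk : LinearMap.ker (Matrix.mulVecLin (A - c • (1 : Matrix (Fin n) (Fin n) ℂ))) = ⊥ := by
    rw [LinearMap.ker_eq_bot]
    exact Matrix.mulVec_injective_of_isUnit hu'
  rw [hk] at h
  simp at h

theorem ode_zero {ι J : Type*} [Fintype ι] [DecidableEq ι] [Fintype J]
    (U : Set (ι → ℝ)) (hU : IsOpen U) (hUc : IsPreconnected U)
    (u : J → (ι → ℝ) → ℝ) (M : ι → J → J → (ι → ℝ) → ℝ)
    (hM : ∀ k j j', ContinuousOn (M k j j') U)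
    (hu : ∀ j, ∀ x ∈ U, DifferentiableAt ℝ (u j) x)
    (h : ∀ k j, ∀ x ∈ U, fderiv ℝ (u j) x (Pi.single k 1) = ∑ j', M k j j' x * u j' x)
    (x₀ : ι → ℝ) (hx₀ : x₀ ∈ U) (h0 : ∀ j, u j x₀ = 0) :
    ∀ x ∈ U, ∀ j, u j x = 0 := by
  let w : (ι → ℝ) → (J → ℝ) := fun x j => u j x
  have hw : ∀ x ∈ U, DifferentiableAt ℝ w x := fun x hx =>
    differentiableAt_pi.mpr (fun j => hu j x hx)
  have hwc : ContinuousOn w U := fun x hx => (hw x hx).continuousAt.continuousWithinAt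
  suffices hs : ∀ x ∈ U, w x = 0 from fun x hx j => congrFun (hs x hx) j
  -- local statement
  have hloc : ∀ x ∈ U, w x = 0 → ∀ᶠ y in nhds x, w y = 0 := by
    intro x hx hwx
    obtain ⟨r, hr, hrU⟩ := Metric.nhds_basis_closedBall.mem_iff.mp (hU.mem_nhds hx)
    have hcomp : IsCompact (Metric.closedBall x r) := isCompact_closedBall x r
    have hb : ∀ k j j', ∃ C : ℝ, ∀ y ∈ Metric.closedBall x r, ‖M k j j' y‖ ≤ C := fun k j j' =>
      hcomp.exists_bound_of_continuousOn ((hM k j j').mono hrU)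
    choose C hC using hb
    have hxr : x ∈ Metric.closedBall x r := Metric.mem_closedBall_self hr.le
    have hC0 : ∀ k j j', 0 ≤ C k j j' := fun k j j' => (norm_nonneg _).trans (hC k j j' x hxr)
    let K : ℝ := ∑ k, r * ∑ j, ∑ j', C k j j'
    have hK0 : 0 ≤ K := Finset.sum_nonneg fun k _ => mul_nonneg hr.le
      (Finset.sum_nonneg fun j _ => Finset.sum_nonneg fun j' _ => hC0 _ _ _)
    filter_upwards [Metric.closedBall_mem_nhds x hr] with y hy
    have hseg : ∀ s ∈ Set.Icc (0:ℝ) 1, x + s • (y - x) ∈ Metric.closedBall x r := by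
      intro s hs
      rw [Metric.mem_closedBall, dist_eq_norm, add_sub_cancel_left, norm_smul]
      rw [Metric.mem_closedBall, dist_eq_norm] at hy
      have : ‖s‖ ≤ 1 := by rw [Real.norm_eq_abs, abs_le]; constructor <;> linarith [hs.1, hs.2]
      nlinarith [norm_nonneg s, norm_nonneg (y - x)]
    let φ : ℝ → (J → ℝ) := fun s => w (x + s • (y - x))
    have hφ : ∀ s ∈ Set.Icc (0:ℝ) 1,
        HasDerivAt φ (fderiv ℝ w (x + s • (y - x)) (y - x)) s := by
      intro s hs
      have h1 : HasDerivAt (fun s : ℝ => x + s • (y - x)) (y - x) s := by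
        simpa using ((hasDerivAt_id s).smul_const (y - x)).const_add x
      exact (hw _ (hrU (hseg s hs))).hasFDerivAt.comp_hasDerivAt s h1
    have hbound : ∀ s ∈ Set.Icc (0:ℝ) 1,
        ‖fderiv ℝ w (x + s • (y - x)) (y - x)‖ ≤ K * ‖φ s‖ + 0 := by
      intro s hs
      set z := x + s • (y - x) with hz
      have hzb := hseg s hs
      have hzU := hrU hzb
      rw [add_zero, pi_norm_le_iff_of_nonneg (mul_nonneg hK0 (norm_nonneg _))]
      intro j
      have e1 : fderiv ℝ w z (y - x) j = fderiv ℝ (u j) z (y - x) := by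
        have := fderiv_pi (𝕜 := ℝ) (φ := u) (x := z) (fun j => hu j z hzU)
        change fderiv ℝ (fun x j => u j x) z (y - x) j = _
        rw [fderiv_pi (fun j => hu j z hzU)]
        rfl
      have e2 : y - x = ∑ k, (y - x) k • (Pi.single k (1:ℝ) : ι → ℝ) :=
        pi_eq_sum_univ' (y - x)
      rw [e1, e2, map_sum]
      simp only [map_smul, smul_eq_mul]
      have hyx : ‖y - x‖ ≤ r := by rwa [Metric.mem_closedBall, dist_eq_norm] at hy
      calc ‖∑ k, (y - x) k * fderiv ℝ (u j) z (Pi.single k 1)‖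
          ≤ ∑ k, ‖(y - x) k * fderiv ℝ (u j) z (Pi.single k 1)‖ := norm_sum_le _ _
        _ ≤ ∑ k, (r * ∑ j, ∑ j', C k j j') * ‖φ s‖ := by
            refine Finset.sum_le_sum fun k _ => ?_
            rw [norm_mul, mul_assoc]
            refine mul_le_mul ((norm_le_pi_norm (y - x) k).trans hyx) ?_ (norm_nonneg _) hr.le
            rw [h k j z hzU]
            calc ‖∑ j', M k j j' z * u j' z‖ ≤ ∑ j', ‖M k j j' z * u j' z‖ := norm_sum_le _ _
              _ ≤ ∑ j', C k j j' * ‖φ s‖ := by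
                  refine Finset.sum_le_sum fun j' _ => ?_
                  rw [norm_mul]
                  exact mul_le_mul (hC k j j' z hzb) (norm_le_pi_norm (φ s) j') (norm_nonneg _)
                    (hC0 _ _ _)
              _ = (∑ j', C k j j') * ‖φ s‖ := by rw [Finset.sum_mul]
              _ ≤ (∑ j, ∑ j', C k j j') * ‖φ s‖ := by
                  refine mul_le_mul_of_nonneg_right ?_ (norm_nonneg _)
                  exact Finset.single_le_sum (f := fun j => ∑ j', C k j j')
                    (fun j _ => Finset.sum_nonneg fun j' _ => hC0 _ _ _) (Finset.mem_univ j)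
        _ = K * ‖φ s‖ := by rw [← Finset.sum_mul]
    have hg := norm_le_gronwallBound_of_norm_deriv_right_le (f := φ) (δ := 0) (K := K) (ε := 0)
      (a := 0) (b := 1) (fun s hs => (hφ s hs).continuousAt.continuousWithinAt)
      (fun s hs => (hφ s ⟨hs.1, hs.2.le⟩).hasDerivWithinAt)
      (by simp [φ, hwx]) (fun s hs => hbound s ⟨hs.1, hs.2.le⟩) 1 ⟨zero_le_one, le_rfl⟩
    rw [gronwallBound_ε0_δ0] at hg
    have : φ 1 = 0 := norm_le_zero_iff.mp hg
    simpa [φ] using this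
  have hsub : U ⊆ {x | ∀ᶠ y in nhds x, w y = 0} := by
    refine hUc.subset_of_closure_inter_subset isOpen_setOfPred_eventually_nhds
      ⟨x₀, hx₀, hloc x₀ hx₀ (funext h0)⟩ ?_
    rintro x ⟨hxcl, hxU⟩
    apply hloc x hxU
    by_contra hne
    have hev : ∀ᶠ y in nhds x, w y ≠ 0 :=
      (hw x hxU).continuousAt.eventually_ne hne
    obtain ⟨y, hy1, hy2⟩ := (mem_closure_iff_nhds.mp hxcl _ hev)
    exact hy1 hy2.self_of_nhds
  exact fun x hx => (hsub hx).self_of_nhds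


theorem petersen {ι : Type*} (D S : ι → ι → ι → ι → ι → ℝ)
    (h1 : ∀ a b c i j, D a b c i j = D b a c i j)
    (h2 : ∀ a b c i j, D a b c i j = D a c b i j)
    (h3 : ∀ a b c i j, D a b c i j = D a b c j i)
    (hS : ∀ a b k i j, D a b k i j + D a b i j k + D a b j k i = S a b k i j)
    (a b c i j : ι) :
    D a b c i j = 1/2 * (S a b c i j + S a c b i j + S b c a i j + S i j a b c)
      - 1/6 * (S a b c i j + S a c b i j + S b c a i j + S i j a b c
        + S a i b c j + S a j b c i + S b i a c j + S b j a c i + S c i a b j + S c j a b i) := by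
  simp only [← hS]
  simp only [h1, h2, h3]
  ring

section prop
set_option linter.unusedSectionVars false
variable {ι : Type*} [Fintype ι] [DecidableEq ι] {U : Set (ι → ℝ)}

theorem sm_diffAt (hU : IsOpen U) {f : (ι → ℝ) → ℝ} (hf : ContDiffOn ℝ (⊤ : ℕ∞) f U)
    {x : ι → ℝ} (hx : x ∈ U) : DifferentiableAt ℝ f x :=
  (hf.contDiffAt (hU.mem_nhds hx)).differentiableAt (by simp)

theorem pd_smooth (hU : IsOpen U) {f : (ι → ℝ) → ℝ} (hf : ContDiffOn ℝ (⊤ : ℕ∞) f U) (i : ι) :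
    ContDiffOn ℝ (⊤ : ℕ∞) (pd i f) U := by
  have : ContDiffOn ℝ (⊤ : ℕ∞) (fderiv ℝ f) U := hf.fderiv_of_isOpen hU (by simp)
  exact this.clm_apply contDiffOn_const

theorem pd_congr (hU : IsOpen U) {f f' : (ι → ℝ) → ℝ} (h : ∀ x ∈ U, f x = f' x) (i : ι) :
    ∀ x ∈ U, pd i f x = pd i f' x := by
  intro x hx
  have : f =ᶠ[nhds x] f' := by
    filter_upwards [hU.mem_nhds hx] with y hy using h y hy
  unfold pd
  rw [this.fderiv_eq]

theorem pd_add {f f' : (ι → ℝ) → ℝ} {x : ι → ℝ} (hf : DifferentiableAt ℝ f x)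
    (hf' : DifferentiableAt ℝ f' x) (i : ι) :
    pd i (fun y => f y + f' y) x = pd i f x + pd i f' x := by
  unfold pd
  rw [fderiv_fun_add hf hf']
  rfl

theorem pd_mul {f f' : (ι → ℝ) → ℝ} {x : ι → ℝ} (hf : DifferentiableAt ℝ f x)
    (hf' : DifferentiableAt ℝ f' x) (i : ι) :
    pd i (fun y => f y * f' y) x = pd i f x * f' x + f x * pd i f' x := by
  unfold pd
  rw [fderiv_fun_mul hf hf']
  simp
  ring

theorem pd_sum {α : Type*} (s : Finset α) {f : α → (ι → ℝ) → ℝ} {x : ι → ℝ}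
    (hf : ∀ a ∈ s, DifferentiableAt ℝ (f a) x) (i : ι) :
    pd i (fun y => ∑ a ∈ s, f a y) x = ∑ a ∈ s, pd i (f a) x := by
  unfold pd
  rw [fderiv_fun_sum hf]
  simp

theorem pd_comm (hU : IsOpen U) {f : (ι → ℝ) → ℝ} (hf : ContDiffOn ℝ (⊤ : ℕ∞) f U) (i j : ι) :
    ∀ x ∈ U, pd i (pd j f) x = pd j (pd i f) x := by
  intro x hx
  have hsym : IsSymmSndFDerivAt ℝ f x :=
    (hf.contDiffAt (hU.mem_nhds hx)).isSymmSndFDerivAt (by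
      simp only [minSmoothness_of_isRCLikeNormedField]; 
      exact WithTop.coe_le_coe.mpr (le_top (a := (2 : ℕ∞))))
  have hd : DifferentiableAt ℝ (fderiv ℝ f) x :=
    ((hf.fderiv_of_isOpen hU (m := 1) (by norm_cast)).contDiffAt
      (hU.mem_nhds hx)).differentiableAt (by simp)
  have key : ∀ i j, pd i (pd j f) x = fderiv ℝ (fderiv ℝ f) x (Pi.single i 1) (Pi.single j 1) := by
    intro i j
    unfold pd
    rw [fderiv_clm_apply hd (differentiableAt_const _)]
    simp
  rw [key, key]
  exact hsym.eq _ _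

/-- membership in the span of a family with continuous coefficients -/
def LJ {J : Type*} [Fintype J] (U : Set (ι → ℝ)) (u : J → (ι → ℝ) → ℝ) (f : (ι → ℝ) → ℝ) : Prop :=
  ∃ M : J → (ι → ℝ) → ℝ, (∀ j, ContinuousOn (M j) U) ∧ ∀ x ∈ U, f x = ∑ j, M j x * u j x

variable {J : Type*} [Fintype J] {u : J → (ι → ℝ) → ℝ}

theorem LJ.congr {f f' : (ι → ℝ) → ℝ} (h : LJ U u f) (e : ∀ x ∈ U, f' x = f x) : LJ U u f' := by
  obtain ⟨M, hM, h⟩ := h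
  exact ⟨M, hM, fun x hx => (e x hx).trans (h x hx)⟩

theorem LJ.add {f f' : (ι → ℝ) → ℝ} (h : LJ U u f) (h' : LJ U u f') :
    LJ U u (fun x => f x + f' x) := by
  obtain ⟨M, hM, h⟩ := h
  obtain ⟨M', hM', h'⟩ := h'
  refine ⟨fun j x => M j x + M' j x, fun j => (hM j).add (hM' j), fun x hx => ?_⟩
  simp only [h x hx, h' x hx, add_mul, Finset.sum_add_distrib]

theorem LJ.cmul {f c : (ι → ℝ) → ℝ} (hc : ContinuousOn c U) (h : LJ U u f) :
    LJ U u (fun x => c x * f x) := by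
  obtain ⟨M, hM, h⟩ := h
  refine ⟨fun j x => c x * M j x, fun j => hc.mul (hM j), fun x hx => ?_⟩
  simp only [h x hx, Finset.mul_sum, mul_assoc]

theorem LJ.const {f : (ι → ℝ) → ℝ} (c : ℝ) (h : LJ U u f) :
    LJ U u (fun x => c * f x) := LJ.cmul continuousOn_const h

theorem LJ.sum {α : Type*} (s : Finset α) {f : α → (ι → ℝ) → ℝ} (h : ∀ a ∈ s, LJ U u (f a)) :
    LJ U u (fun x => ∑ a ∈ s, f a x) := by
  classical
  induction s using Finset.induction_on with
  | empty => exact ⟨fun _ _ => 0, fun _ => continuousOn_const, by simp⟩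
  | insert a s ha ih =>
    simp only [Finset.sum_insert ha]
    exact (h a (by simp)).add (ih fun b hb => h b (by simp [hb]))

theorem LJ.mem (j : J) : LJ U u (u j) := by
  classical
  refine ⟨fun j' _ => if j' = j then 1 else 0, fun _ => continuousOn_const, fun x _ => ?_⟩
  simp

/-- right-hand side of the Killing equation -/
def RK (Γ : ι → ι → ι → (ι → ℝ) → ℝ) (κ : ι → ι → (ι → ℝ) → ℝ) (k i j : ι) (x : ι → ℝ) : ℝ :=
  ∑ l, (Γ l k i x * κ l j x + Γ l k j x * κ i l x)

/-- Killing equation -/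
def Killing (U : Set (ι → ℝ)) (Γ : ι → ι → ι → (ι → ℝ) → ℝ) (κ : ι → ι → (ι → ℝ) → ℝ) : Prop :=
  ∀ x ∈ U, ∀ k i j, pd k (κ i j) x + pd i (κ j k) x + pd j (κ k i) x
    = RK Γ κ k i j x + RK Γ κ i j k x + RK Γ κ j k i x

/-- the two-jet of a tensor -/
noncomputable def jet (κ : ι → ι → (ι → ℝ) → ℝ) :
    (ι × ι) ⊕ (ι × ι × ι) ⊕ (ι × ι × ι × ι) → (ι → ℝ) → ℝ
  | .inl (i, j) => κ i j
  | .inr (.inl (a, i, j)) => pd a (κ i j)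
  | .inr (.inr (a, b, i, j)) => pd a (pd b (κ i j))

theorem pdpd_add (hU : IsOpen U) {f f' : (ι → ℝ) → ℝ} (hf : ContDiffOn ℝ (⊤ : ℕ∞) f U)
    (hf' : ContDiffOn ℝ (⊤ : ℕ∞) f' U) (a b : ι) :
    ∀ x ∈ U, pd a (pd b (fun y => f y + f' y)) x = pd a (pd b f) x + pd a (pd b f') x := by
  intro x hx
  rw [pd_congr hU (fun y hy => pd_add (sm_diffAt hU hf hy) (sm_diffAt hU hf' hy) b) a x hx]
  exact pd_add (sm_diffAt hU (pd_smooth hU hf b) hx) (sm_diffAt hU (pd_smooth hU hf' b) hx) a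

theorem pdpd_sum (hU : IsOpen U) {α : Type*} (s : Finset α) {f : α → (ι → ℝ) → ℝ}
    (hf : ∀ l, ContDiffOn ℝ (⊤ : ℕ∞) (f l) U) (a b : ι) :
    ∀ x ∈ U, pd a (pd b (fun y => ∑ l ∈ s, f l y)) x = ∑ l ∈ s, pd a (pd b (f l)) x := by
  intro x hx
  rw [pd_congr hU (fun y hy => pd_sum s (fun l _ => sm_diffAt hU (hf l) hy) b) a x hx]
  exact pd_sum s (fun l _ => sm_diffAt hU (pd_smooth hU (hf l) b) hx) a

theorem LJ_pdpd_mul (hU : IsOpen U) {κ : ι → ι → (ι → ℝ) → ℝ}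
    (hκ : ∀ i j, ContDiffOn ℝ (⊤ : ℕ∞) (κ i j) U) {c : (ι → ℝ) → ℝ}
    (hc : ContDiffOn ℝ (⊤ : ℕ∞) c U) (a b i j : ι) :
    LJ U (jet κ) (pd a (pd b (fun y => c y * κ i j y))) := by
  have e : ∀ x ∈ U, pd a (pd b (fun y => c y * κ i j y)) x =
      ((pd a (pd b c) x * κ i j x + pd b c x * pd a (κ i j) x)
        + (pd a c x * pd b (κ i j) x + c x * pd a (pd b (κ i j)) x)) := by
    intro x hx
    rw [pd_congr hU (fun y hy => pd_mul (sm_diffAt hU hc hy) (sm_diffAt hU (hκ i j) hy) b) a x hx]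
    have d1 := sm_diffAt hU hc hx
    have d2 := sm_diffAt hU (hκ i j) hx
    have d3 := sm_diffAt hU (pd_smooth hU hc b) hx
    have d4 := sm_diffAt hU (pd_smooth hU (hκ i j) b) hx
    rw [pd_add (d3.fun_mul d2) (d1.fun_mul d4), pd_mul d3 d2, pd_mul d1 d4]
  have m0 : LJ U (jet κ) (κ i j) := LJ.mem (u := jet κ) (.inl (i, j))
  have m1 : ∀ a, LJ U (jet κ) (pd a (κ i j)) := fun a =>
    LJ.mem (u := jet κ) (.inr (.inl (a, i, j)))
  have m2 : LJ U (jet κ) (pd a (pd b (κ i j))) :=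
    LJ.mem (u := jet κ) (.inr (.inr (a, b, i, j)))
  refine LJ.congr ?_ e
  exact ((LJ.cmul (pd_smooth hU (pd_smooth hU hc b) a).continuousOn m0).add
    (LJ.cmul (pd_smooth hU hc b).continuousOn (m1 a))).add
    ((LJ.cmul (pd_smooth hU hc a).continuousOn (m1 b)).add (LJ.cmul hc.continuousOn m2))

theorem RK_smooth {κ : ι → ι → (ι → ℝ) → ℝ} {Γ : ι → ι → ι → (ι → ℝ) → ℝ}
    (hκ : ∀ i j, ContDiffOn ℝ (⊤ : ℕ∞) (κ i j) U)
    (hΓ : ∀ l k i, ContDiffOn ℝ (⊤ : ℕ∞) (Γ l k i) U) (k i j : ι) :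
    ContDiffOn ℝ (⊤ : ℕ∞) (RK Γ κ k i j) U := by
  unfold RK
  exact ContDiffOn.sum fun l _ => ((hΓ _ _ _).mul (hκ _ _)).add ((hΓ _ _ _).mul (hκ _ _))

theorem LJ_pdpd_RK (hU : IsOpen U) {κ : ι → ι → (ι → ℝ) → ℝ} {Γ : ι → ι → ι → (ι → ℝ) → ℝ}
    (hκ : ∀ i j, ContDiffOn ℝ (⊤ : ℕ∞) (κ i j) U)
    (hΓ : ∀ l k i, ContDiffOn ℝ (⊤ : ℕ∞) (Γ l k i) U) (a b k i j : ι) :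
    LJ U (jet κ) (pd a (pd b (RK Γ κ k i j))) := by
  have e : ∀ x ∈ U, pd a (pd b (RK Γ κ k i j)) x = ∑ l,
      (pd a (pd b (fun x => Γ l k i x * κ l j x)) x
        + pd a (pd b (fun x => Γ l k j x * κ i l x)) x) := by
    intro x hx
    unfold RK
    rw [pdpd_sum hU _ (fun l => ((hΓ _ _ _).mul (hκ _ _)).add ((hΓ _ _ _).mul (hκ _ _))) a b x hx]
    exact Finset.sum_congr rfl fun l _ =>
      pdpd_add hU ((hΓ _ _ _).mul (hκ _ _)) ((hΓ _ _ _).mul (hκ _ _)) a b x hx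
  exact LJ.congr (LJ.sum _ fun l _ => (LJ_pdpd_mul hU hκ (hΓ _ _ _) a b _ _).add
    (LJ_pdpd_mul hU hκ (hΓ _ _ _) a b _ _)) e

theorem propagate (hU : IsOpen U) (hUc : IsPreconnected U)
    {κ : ι → ι → (ι → ℝ) → ℝ} {Γ : ι → ι → ι → (ι → ℝ) → ℝ}
    (hκ : ∀ i j, ContDiffOn ℝ (⊤ : ℕ∞) (κ i j) U)
    (hΓ : ∀ l k i, ContDiffOn ℝ (⊤ : ℕ∞) (Γ l k i) U)
    (hsym : ∀ i j, ∀ x ∈ U, κ i j x = κ j i x)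
    (hK : Killing U Γ κ) {V : Set (ι → ℝ)} (hV : IsOpen V) (hVU : V ⊆ U) (hne : V.Nonempty)
    (h0 : ∀ x ∈ V, ∀ i j, κ i j x = 0) :
    ∀ x ∈ U, ∀ i j, κ i j x = 0 := by
  obtain ⟨x₀, hx₀⟩ := hne
  -- third derivatives
  let S : ι → ι → ι → ι → ι → (ι → ℝ) → ℝ := fun a b k i j x =>
    pd a (pd b (RK Γ κ k i j)) x + pd a (pd b (RK Γ κ i j k)) x + pd a (pd b (RK Γ κ j k i)) x
  have hSL : ∀ a b k i j, LJ U (jet κ) (S a b k i j) := fun a b k i j =>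
    ((LJ_pdpd_RK hU hκ hΓ a b k i j).add (LJ_pdpd_RK hU hκ hΓ a b i j k)).add
      (LJ_pdpd_RK hU hκ hΓ a b j k i)
  have h3 : ∀ a b c i j, LJ U (jet κ) (pd a (pd b (pd c (κ i j)))) := by
    intro a b c i j
    have e : ∀ x ∈ U, pd a (pd b (pd c (κ i j))) x =
      1/2 * (S a b c i j x + S a c b i j x + S b c a i j x + S i j a b c x)
      + (-1/6) * (S a b c i j x + S a c b i j x + S b c a i j x + S i j a b c x
        + S a i b c j x + S a j b c i x + S b i a c j x + S b j a c i x
        + S c i a b j x + S c j a b i x) := by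
      intro x hx
      have := petersen (fun a b c i j => pd a (pd b (pd c (κ i j))) x)
        (fun a b k i j => S a b k i j x)
        (fun a b c i j => pd_comm hU (pd_smooth hU (hκ i j) c) a b x hx)
        (fun a b c i j => pd_congr hU (pd_comm hU (hκ i j) b c) a x hx)
        (fun a b c i j => pd_congr hU (pd_congr hU (pd_congr hU (hsym i j) c) b) a x hx)
        ?_ a b c i j
      · rw [this]; ring
      · intro a b k i j
        have p1 := fun k i j => pd_smooth hU (hκ i j) k
        have r1 := fun k i j => RK_smooth hκ hΓ k i j
        have := pd_congr hU (pd_congr hU (fun y hy => hK y hy k i j) b) a x hx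
        rw [pdpd_add hU ((p1 _ _ _).add (p1 _ _ _)) (p1 _ _ _) a b x hx,
          pdpd_add hU (p1 _ _ _) (p1 _ _ _) a b x hx,
          pdpd_add hU ((r1 _ _ _).add (r1 _ _ _)) (r1 _ _ _) a b x hx,
          pdpd_add hU (r1 _ _ _) (r1 _ _ _) a b x hx] at this
        exact this
    refine LJ.congr ?_ e
    exact (LJ.const _ ((((hSL _ _ _ _ _).add (hSL _ _ _ _ _)).add (hSL _ _ _ _ _)).add
      (hSL _ _ _ _ _))).add (LJ.const _ ((((((((((hSL _ _ _ _ _).add (hSL _ _ _ _ _)).add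
      (hSL _ _ _ _ _)).add (hSL _ _ _ _ _)).add (hSL _ _ _ _ _)).add (hSL _ _ _ _ _)).add
      (hSL _ _ _ _ _)).add (hSL _ _ _ _ _)).add (hSL _ _ _ _ _)).add (hSL _ _ _ _ _)))
  have hall : ∀ k j, LJ U (jet κ) (pd k (jet κ j)) := by
    rintro k (⟨i, j⟩ | ⟨a, i, j⟩ | ⟨a, b, i, j⟩)
    · exact LJ.mem (u := jet κ) (.inr (.inl (k, i, j)))
    · exact LJ.mem (u := jet κ) (.inr (.inr (k, a, i, j)))
    · exact h3 k a b i j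
  have hjs : ∀ j, ContDiffOn ℝ (⊤ : ℕ∞) (jet κ j) U := by
    rintro (⟨i, j⟩ | ⟨a, i, j⟩ | ⟨a, b, i, j⟩)
    · exact hκ i j
    · exact pd_smooth hU (hκ i j) a
    · exact pd_smooth hU (pd_smooth hU (hκ i j) b) a
  choose M hM hME using hall
  have z0 : ∀ i j, ∀ x ∈ V, κ i j x = (fun _ => (0:ℝ)) x := fun i j x hx => h0 x hx i j
  have pz : ∀ a : ι, (pd a (fun _ => (0:ℝ))) = fun _ => 0 := by
    intro a; funext x; simp [pd]
  have := ode_zero U hU hUc (jet κ) M hM (fun j x hx => sm_diffAt hU (hjs j) hx)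
    (fun k j x hx => hME k j x hx) x₀ (hVU hx₀) (by
      rintro (⟨i, j⟩ | ⟨a, i, j⟩ | ⟨a, b, i, j⟩)
      · exact h0 x₀ hx₀ i j
      · have := pd_congr hV (z0 i j) a x₀ hx₀
        rw [pz] at this
        exact this
      · have := pd_congr hV (pd_congr hV (z0 i j) b) a x₀ hx₀
        rw [pz, pz] at this
        exact this)
  exact fun x hx i j => this x hx (.inl (i, j))
end prop

section lam
variable {ι : Type*} [Fintype ι] [DecidableEq ι] {U : Set (ι → ℝ)}

theorem hasFDerivAt_mul_cont {E : Type*} [NormedAddCommGroup E] [NormedSpace ℝ E]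
    {f h : E → ℂ} {f' : E →L[ℝ] ℂ} {x : E} (hf : HasFDerivAt f f' x) (h0 : f x = 0)
    (hc : ContinuousAt h x) : HasFDerivAt (fun y => h y * f y) (h x • f') x := by
  have h1 : HasFDerivAt (fun y => h x * f y) (h x • f') x := hf.const_mul (h x)
  have h2 : HasFDerivAt (fun y => (h y - h x) * f y) (0 : E →L[ℝ] ℂ) x := by
    rw [hasFDerivAt_iff_isLittleO]
    simp only [h0, mul_zero, sub_zero, _root_.zero_apply]
    have o1 : (fun y => h y - h x) =o[nhds x] (fun _ => (1:ℝ)) := by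
      rw [Asymptotics.isLittleO_one_iff]
      have : Filter.Tendsto (fun y => h y - h x) (nhds x) (nhds (h x - h x)) :=
        hc.tendsto.sub tendsto_const_nhds
      simpa using this
    have o2 : f =O[nhds x] (fun y => ‖y - x‖) := by
      have := hf.isBigO_sub
      simp only [h0, sub_zero] at this
      exact this.norm_right
    have := o1.mul_isBigO o2
    simp only [one_mul] at this
    exact this.of_norm_right
  have h3 := h1.add h2
  rw [add_zero] at h3
  refine h3.congr_of_eventuallyEq (Filter.Eventually.of_forall fun y => ?_)
  simp only [Pi.add_apply]
  ring

theorem sym_prod_zero {ι : Type*} (l : ι → ℂ) (W : ι → ι → ℂ) (hs : ∀ i j, W i j = W j i)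
    (h : ∀ k i j, l k * W i j + l i * W j k + l j * W k i = 0)
    (i₀ j₀ : ι) (hW : W i₀ j₀ ≠ 0) (k : ι) : l k = 0 := by
  by_contra hk
  have h1 : W k k = 0 := by
    have := h k k k
    have h3 : l k * W k k = 0 := by linear_combination this / 3
    simpa [hk] using h3
  have h2 : ∀ j, W k j = 0 := by
    intro j
    have := h k k j
    rw [h1, hs j k] at this
    have h3 : l k * W k j = 0 := by linear_combination this / 2
    simpa [hk] using h3
  have := h k i₀ j₀
  rw [h2, hs j₀ k, h2] at this
  simp [hk, hW] at this

theorem aeval_sum {N : ℕ} (Q : ℝ[X]) (hQ : Q.natDegree < N) (z : ℂ) :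
    aeval z Q = ∑ a ∈ Finset.range N, ((Q.coeff a : ℝ) : ℂ) * z ^ a := by
  rw [aeval_eq_sum_range' hQ]
  simp

theorem aeval_deriv_sum {N : ℕ} (Q : ℝ[X]) (hQ : Q.natDegree < N) (z : ℂ) :
    aeval z (derivative Q) =
      ∑ a ∈ Finset.range N, ((Q.coeff a : ℝ) : ℂ) * ((a : ℂ) * z ^ (a - 1)) := by
  conv_lhs => rw [Q.as_sum_range' N hQ]
  simp only [map_sum, derivative_monomial, aeval_monomial]
  refine Finset.sum_congr rfl fun a _ => ?_
  simp [mul_assoc]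

theorem aeval_cont {E : Type*} [TopologicalSpace E] {N : ℕ} {Q : E → ℝ[X]} {x : E} {z : E → ℂ}
    (hQ : ∀ y, (Q y).natDegree < N)
    (hc : ∀ a, ContinuousAt (fun y => (Q y).coeff a) x) (hz : ContinuousAt z x) :
    ContinuousAt (fun y => aeval (z y) (Q y)) x := by
  have : (fun y => aeval (z y) (Q y)) =
      fun y => ∑ a ∈ Finset.range N, (((Q y).coeff a : ℝ) : ℂ) * (z y) ^ a := by
    funext y; exact aeval_sum _ (hQ y) _
  rw [this]
  refine tendsto_finsetSum _ fun a _ => ?_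
  exact ContinuousAt.mul (Complex.continuous_ofReal.continuousAt.comp (hc a)) (hz.pow a)

theorem lam_local {N : ℕ} {Q : (ι → ℝ) → ι → ι → ℝ[X]} {Γ : ι → ι → ι → (ι → ℝ) → ℝ}
    {x₀ : ι → ℝ} (hx₀ : x₀ ∈ U)
    (hN : ∀ y i j, (Q y i j).natDegree < N)
    (hd : ∀ a i j, DifferentiableAt ℝ (fun y => (Q y i j).coeff a) x₀)
    (hsym : ∀ i j, Q x₀ i j = Q x₀ j i)
    (hK : ∀ a, Killing U Γ (fun i j y => (Q y i j).coeff a))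
    {lam : (ι → ℝ) → ℂ} (hlam : ContinuousAt lam x₀)
    (hz : ∀ᶠ y in nhds x₀, ∀ i j, aeval (lam y) (Q y i j) = 0)
    {i₀ j₀ : ι} (hW : aeval (lam x₀) (derivative (Q x₀ i₀ j₀)) ≠ 0) :
    HasFDerivAt lam (0 : (ι → ℝ) →L[ℝ] ℂ) x₀ := by
  set z := lam x₀ with hzdef
  let W : ι → ι → ℂ := fun i j => aeval z (derivative (Q x₀ i j))
  let f : ι → ι → (ι → ℝ) → ℂ := fun i j y => aeval z (Q y i j)
  let f' : ι → ι → (ι → ℝ) →L[ℝ] ℂ := fun i j => ∑ a ∈ Finset.range N,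
    (z ^ a) • (Complex.ofRealCLM.comp (fderiv ℝ (fun y => (Q y i j).coeff a) x₀))
  have hf0 : ∀ i j, f i j x₀ = 0 := fun i j => hz.self_of_nhds i j
  have hff : ∀ i j, HasFDerivAt (f i j) (f' i j) x₀ := by
    intro i j
    have e : f i j = fun y => ∑ a ∈ Finset.range N, (((Q y i j).coeff a : ℝ) : ℂ) * z ^ a := by
      funext y; exact aeval_sum _ (hN y i j) _
    rw [e]
    refine HasFDerivAt.fun_sum fun a _ => ?_
    exact ((Complex.ofRealCLM.hasFDerivAt).comp x₀ (hd a i j).hasFDerivAt).mul_const (z ^ a)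
  let q : ι → ι → (ι → ℝ) → ℂ := fun i j y => ∑ a ∈ Finset.range N,
    (((Q y i j).coeff a : ℝ) : ℂ) * ∑ b ∈ Finset.range a, lam y ^ b * z ^ (a - 1 - b)
  have hq0 : ∀ i j, q i j x₀ = W i j := by
    intro i j
    simp only [q, W]
    rw [aeval_deriv_sum _ (hN x₀ i j)]
    refine Finset.sum_congr rfl fun a _ => ?_
    rw [← hzdef, geom_sum₂_self]
  have hqc : ∀ i j, ContinuousAt (q i j) x₀ := by
    intro i j
    refine tendsto_finsetSum _ fun a _ => ?_
    refine ContinuousAt.mul (Complex.continuous_ofReal.continuousAt.comp (hd a i j).continuousAt) ?_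
    refine tendsto_finsetSum _ fun b _ => ?_
    exact ContinuousAt.mul (hlam.pow b) continuousAt_const
  have hrel : ∀ᶠ y in nhds x₀, ∀ i j, f i j y = - (q i j y * (lam y - z)) := by
    filter_upwards [hz] with y hy i j
    have h1 := hy i j
    rw [aeval_sum _ (hN y i j)] at h1
    have h2 : q i j y * (lam y - z) = ∑ a ∈ Finset.range N,
        ((((Q y i j).coeff a : ℝ) : ℂ) * lam y ^ a - (((Q y i j).coeff a : ℝ) : ℂ) * z ^ a) := by
      simp only [q, Finset.sum_mul]
      refine Finset.sum_congr rfl fun a _ => ?_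
      rw [mul_assoc, geom_sum₂_mul]
      ring
    rw [h2, Finset.sum_sub_distrib, h1]
    simp only [f]
    rw [aeval_sum _ (hN y i j)]
    ring
  -- differentiability
  have hWne : q i₀ j₀ x₀ ≠ 0 := by rw [hq0]; exact hW
  obtain ⟨D, hD⟩ : ∃ D : (ι → ℝ) →L[ℝ] ℂ, HasFDerivAt lam D x₀ := by
    have h1 := (hasFDerivAt_mul_cont (hff i₀ j₀) (hf0 i₀ j₀)
      ((hqc i₀ j₀).inv₀ hWne).neg).add_const z
    refine ⟨_, h1.congr_of_eventuallyEq ?_⟩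
    filter_upwards [hrel, (hqc i₀ j₀).eventually_ne hWne] with y hy hne
    rw [hy i₀ j₀]
    simp only [Pi.neg_apply, Pi.inv_apply]
    field_simp
    ring
  have hfD : ∀ i j, f' i j = -(W i j • D) := by
    intro i j
    have h1 := (hasFDerivAt_mul_cont (hD.sub_const z) (by simp [← hzdef]) (hqc i j)).neg
    rw [hq0] at h1
    refine (hff i j).unique (h1.congr_of_eventuallyEq ?_)
    filter_upwards [hrel] with y hy
    exact hy i j
  have hcyc : ∀ k i j, D (Pi.single k 1) * W i j + D (Pi.single i 1) * W j k
      + D (Pi.single j 1) * W k i = 0 := by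
    intro k i j
    have hf'v : ∀ k i j, f' i j (Pi.single k 1) = ∑ a ∈ Finset.range N,
        z ^ a * ((pd k (fun y => (Q y i j).coeff a) x₀ : ℝ) : ℂ) := by
      intro k i j
      simp [f', pd]
    have hfD' : ∀ k i j, D (Pi.single k 1) * W i j = - f' i j (Pi.single k 1) := by
      intro k i j
      rw [hfD]
      simp [mul_comm]
    have hR : ∀ k i j, ∑ a ∈ Finset.range N,
        z ^ a * ((RK Γ (fun i j y => (Q y i j).coeff a) k i j x₀ : ℝ) : ℂ) = 0 := by
      intro k i j
      have e : ∀ i j, ∑ a ∈ Finset.range N, (((Q x₀ i j).coeff a : ℝ) : ℂ) * z ^ a = 0 := by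
        intro i j
        rw [← aeval_sum _ (hN x₀ i j)]
        exact hf0 i j
      calc ∑ a ∈ Finset.range N,
          z ^ a * ((RK Γ (fun i j y => (Q y i j).coeff a) k i j x₀ : ℝ) : ℂ)
          = ∑ l, ((Γ l k i x₀ : ℂ) * ∑ a ∈ Finset.range N, (((Q x₀ l j).coeff a : ℝ) : ℂ) * z ^ a
            + (Γ l k j x₀ : ℂ) *
              ∑ a ∈ Finset.range N, (((Q x₀ i l).coeff a : ℝ) : ℂ) * z ^ a) := by
            simp only [RK, Complex.ofReal_sum, Finset.mul_sum]
            rw [Finset.sum_comm]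
            refine Finset.sum_congr rfl fun l _ => ?_
            rw [← Finset.sum_add_distrib]
            refine Finset.sum_congr rfl fun a _ => ?_
            push_cast
            ring
        _ = 0 := by simp [e]
    have hsum : ∑ a ∈ Finset.range N, z ^ a * ((pd k (fun y => (Q y i j).coeff a) x₀
        + pd i (fun y => (Q y j k).coeff a) x₀ + pd j (fun y => (Q y k i).coeff a) x₀ : ℝ) : ℂ)
        = 0 := by
      have h1 : ∀ a, pd k (fun y => (Q y i j).coeff a) x₀
        + pd i (fun y => (Q y j k).coeff a) x₀ + pd j (fun y => (Q y k i).coeff a) x₀ = _ :=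
        fun a => hK a x₀ hx₀ k i j
      simp only [h1, Complex.ofReal_add, mul_add, Finset.sum_add_distrib, hR, add_zero]
    simp only [Complex.ofReal_add, mul_add, Finset.sum_add_distrib, ← hf'v] at hsum
    rw [hfD', hfD', hfD']
    linear_combination -hsum
  have hDz : ∀ k, D (Pi.single k 1) = 0 :=
    sym_prod_zero (fun k => D (Pi.single k 1)) W (fun i j => by simp only [W, hsym i j]) hcyc i₀ j₀ hW
  have : D = 0 := by
    ext v
    rw [pi_eq_sum_univ' v, map_sum]
    simp [hDz]
  rwa [this] at hD

theorem pd_const_mul {f : (ι → ℝ) → ℝ} {x : ι → ℝ} (hf : DifferentiableAt ℝ f x) (c : ℝ) (i : ι) :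
    pd i (fun y => c * f y) x = c * pd i f x := by
  unfold pd
  rw [fderiv_const_mul hf]
  rfl

theorem Killing.lincomb (hU : IsOpen U) {α : Type*} (s : Finset α) (c : α → ℝ)
    {κ : α → ι → ι → (ι → ℝ) → ℝ} {Γ : ι → ι → ι → (ι → ℝ) → ℝ}
    (hκ : ∀ a i j, ContDiffOn ℝ (⊤ : ℕ∞) (κ a i j) U) (hK : ∀ a, Killing U Γ (κ a)) :
    Killing U Γ (fun i j x => ∑ a ∈ s, c a * κ a i j x) := by
  intro x hx k i j
  have e1 : ∀ k i j, pd k (fun x => ∑ a ∈ s, c a * κ a i j x) x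
      = ∑ a ∈ s, c a * pd k (κ a i j) x := by
    intro k i j
    rw [pd_sum s (fun a _ => (sm_diffAt hU (hκ a i j) hx).const_mul (c a)) k]
    exact Finset.sum_congr rfl fun a _ => pd_const_mul (sm_diffAt hU (hκ a i j) hx) _ _
  have e2 : ∀ k i j, RK Γ (fun i j x => ∑ a ∈ s, c a * κ a i j x) k i j x
      = ∑ a ∈ s, c a * RK Γ (κ a) k i j x := by
    intro k i j
    simp only [RK, Finset.mul_sum]
    rw [Finset.sum_comm]
    refine Finset.sum_congr rfl fun l _ => ?_
    rw [← Finset.sum_add_distrib]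
    refine Finset.sum_congr rfl fun a _ => ?_
    ring
  simp only [e1, e2, ← Finset.sum_add_distrib, ← mul_add]
  exact Finset.sum_congr rfl fun a _ => by rw [hK a x hx k i j]

theorem exists_iter_deriv_ne {Q : ℝ[X]} (hQ : Q ≠ 0) (z : ℂ) :
    ∃ p, aeval z (derivative^[p] Q) ≠ 0 := by
  refine ⟨Q.natDegree, ?_⟩
  have h1 : (derivative^[Q.natDegree] Q).natDegree ≤ 0 := by
    simpa using natDegree_iterate_derivative Q Q.natDegree
  rw [eq_C_of_natDegree_le_zero h1, aeval_C, coeff_iterate_derivative]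
  simp [hQ, Nat.descFactorial_self, Nat.factorial_ne_zero]

theorem lam_main (hU : IsOpen U) (hUc : IsPreconnected U) {N : ℕ}
    {P : (ι → ℝ) → ι → ι → ℝ[X]} {Γ : ι → ι → ι → (ι → ℝ) → ℝ}
    (hΓ : ∀ l k i, ContDiffOn ℝ (⊤ : ℕ∞) (Γ l k i) U)
    (hN : ∀ y i j, (P y i j).natDegree < N)
    (hP : ∀ a i j, ContDiffOn ℝ (⊤ : ℕ∞) (fun y => (P y i j).coeff a) U)
    (hsym : ∀ x ∈ U, ∀ i j, P x i j = P x j i)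
    (hK : ∀ a, Killing U Γ (fun i j y => (P y i j).coeff a))
    (hne : ∀ x ∈ U, ∃ i j, P x i j ≠ 0)
    {V : Set (ι → ℝ)} (hVU : V ⊆ U) (hVne : V.Nonempty) (hV : IsOpen V) (hVc : IsPreconnected V)
    {lam : (ι → ℝ) → ℂ} (hlam : ContinuousOn lam V)
    (hz : ∀ x ∈ V, ∀ i j, aeval (lam x) (P x i j) = 0) :
    ∃ c, (∀ x ∈ V, lam x = c) ∧ ∀ x ∈ U, ∀ i j, aeval c (P x i j) = 0 := by
  -- local constancy somewhere
  have hloc : ∀ V' ⊆ V, IsOpen V' → V'.Nonempty → ∃ B ⊆ V', IsOpen B ∧ B.Nonempty ∧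
      ∃ c, ∀ x ∈ B, lam x = c := by
    intro V' hV'V hV' hV'ne
    have hex : ∃ p, ∃ x ∈ V', ∃ i j, aeval (lam x) (derivative^[p] (P x i j)) ≠ 0 := by
      obtain ⟨x, hx⟩ := hV'ne
      obtain ⟨i, j, hij⟩ := hne x (hVU (hV'V hx))
      obtain ⟨p, hp⟩ := exists_iter_deriv_ne hij (lam x)
      exact ⟨p, x, hx, i, j, hp⟩
    classical
    obtain ⟨x₀, hx₀, i₀, j₀, hp⟩ := Nat.find_spec hex
    have hmin := fun m => Nat.find_min hex (m := m)
    generalize Nat.find hex = p at hp hmin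
    obtain _ | q := p
    · exact absurd (hz x₀ (hV'V hx₀) i₀ j₀) hp
    have hQ0 : ∀ x ∈ V', ∀ i j, aeval (lam x) (derivative^[q] (P x i j)) = 0 := by
      intro x hx i j
      by_contra hcon
      exact hmin q (Nat.lt_succ_self q) ⟨x, hx, i, j, hcon⟩
    have hco : ∀ q a i j y, (derivative^[q] (P y i j)).coeff a
        = ((a + q).descFactorial q : ℝ) * (P y i j).coeff (a + q) := by
      intro q a i j y
      rw [coeff_iterate_derivative]; simp
    have hNq : ∀ q y i j, (derivative^[q] (P y i j)).natDegree < N := fun q y i j =>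
      (natDegree_iterate_derivative _ _).trans_lt ((Nat.sub_le _ _).trans_lt (hN y i j))
    have hPq : ∀ q a i j, ContDiffOn ℝ (⊤ : ℕ∞) (fun y => (derivative^[q] (P y i j)).coeff a) U := by
      intro q a i j
      simp only [hco]
      exact contDiffOn_const.mul (hP _ _ _)
    have hKq : ∀ q a, Killing U Γ (fun i j y => (derivative^[q] (P y i j)).coeff a) := by
      intro q a
      have := Killing.lincomb hU {a} (fun a => ((a + q).descFactorial q : ℝ))
        (κ := fun a i j y => (P y i j).coeff (a + q)) (fun a i j => hP _ _ _) (fun a => hK (a + q))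
      simp only [Finset.sum_singleton] at this
      simpa only [hco] using this
    have hlamc : ∀ x ∈ V', ContinuousAt lam x := fun x hx =>
      hlam.continuousAt (hV.mem_nhds (hV'V hx))
    have hev : ∀ᶠ y in nhds x₀, y ∈ V' ∧
        aeval (lam y) (derivative^[q + 1] (P y i₀ j₀)) ≠ 0 := by
      refine (hV'.eventually_mem hx₀).and ?_
      exact (aeval_cont (fun y => hNq (q+1) y i₀ j₀)
        (fun a => (sm_diffAt hU (hPq (q+1) a i₀ j₀) (hVU (hV'V hx₀))).continuousAt)
        (hlamc x₀ hx₀)).eventually_ne hp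
    obtain ⟨r, hr, hball⟩ := Metric.eventually_nhds_iff_ball.mp hev
    have hder : ∀ y ∈ Metric.ball x₀ r, HasFDerivAt lam (0 : (ι → ℝ) →L[ℝ] ℂ) y := by
      intro y hy
      obtain ⟨hyV, hyne⟩ := hball y hy
      refine lam_local (Q := fun y i j => derivative^[q] (P y i j)) (hVU (hV'V hyV)) (hNq q)
        (fun a i j => sm_diffAt hU (hPq q a i j) (hVU (hV'V hyV)))
        (fun i j => by rw [hsym y (hVU (hV'V hyV))]) (hKq q) (hlamc y hyV) ?_
        (i₀ := i₀) (j₀ := j₀) ?_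
      · filter_upwards [hV'.mem_nhds hyV] with w hw using hQ0 w hw
      · rw [Function.iterate_succ_apply'] at hyne
        exact hyne
    refine ⟨Metric.ball x₀ r, fun y hy => (hball y hy).1, Metric.isOpen_ball,
      ⟨x₀, Metric.mem_ball_self hr⟩, ?_⟩
    exact Metric.isOpen_ball.exists_is_const_of_fderiv_eq_zero (𝕜 := ℝ)
      (convex_ball x₀ r).isPreconnected
      (fun y hy => (hder y hy).differentiableAt.differentiableWithinAt)
      (fun y hy => (hder y hy).fderiv)
  -- propagation
  have hprop : ∀ B ⊆ V, IsOpen B → B.Nonempty → ∀ c, (∀ x ∈ B, lam x = c) →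
      ∀ x ∈ U, ∀ i j, aeval c (P x i j) = 0 := by
    intro B hBV hB hBne c hc
    have gen : ∀ φ : ℂ →ₗ[ℝ] ℝ, ∀ x ∈ U, ∀ i j, φ (aeval c (P x i j)) = 0 := by
      intro φ
      have e : ∀ x i j, φ (aeval c (P x i j))
          = ∑ a ∈ Finset.range N, φ (c ^ a) * (P x i j).coeff a := by
        intro x i j
        rw [aeval_eq_sum_range' (hN x i j), map_sum]
        refine Finset.sum_congr rfl fun a _ => ?_
        rw [map_smul, smul_eq_mul, mul_comm]
      have := propagate hU hUc (κ := fun i j x => ∑ a ∈ Finset.range N, φ (c ^ a) * (P x i j).coeff a)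
        (fun i j => ContDiffOn.sum fun a _ => contDiffOn_const.mul (hP a i j)) hΓ
        (fun i j x hx => by simp only [hsym x hx i j])
        (Killing.lincomb hU (Finset.range N) (fun a => φ (c ^ a))
          (κ := fun a i j y => (P y i j).coeff a) hP hK) hB (hBV.trans hVU) hBne
        (fun x hx i j => by
          have h1 := hz x (hBV hx) i j
          rw [hc x hx] at h1
          simp only [← e, h1, map_zero])
      intro x hx i j
      rw [e]
      exact this x hx i j
    intro x hx i j
    exact Complex.ext (gen Complex.reLm x hx i j) (gen Complex.imLm x hx i j)
  let F : Set ℂ := {c | ∀ x ∈ U, ∀ i j, aeval c (P x i j) = 0}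
  have hF : F.Finite := by
    obtain ⟨x, hx⟩ := hVne
    obtain ⟨i, j, hij⟩ := hne x (hVU hx)
    refine ((P x i j).rootSet_finite ℂ).subset fun c hc => ?_
    exact (mem_rootSet_of_ne hij).mpr (hc x (hVU hx) i j)
  have hmaps : Set.MapsTo lam V F := by
    intro x hx
    by_contra hxF
    have hev : ∀ᶠ y in nhds x, y ∈ V ∧ lam y ∉ F :=
      (hV.eventually_mem hx).and
        ((hlam.continuousAt (hV.mem_nhds hx)).eventually (hF.isClosed.isOpen_compl.mem_nhds hxF))
    obtain ⟨r, hr, hball⟩ := Metric.eventually_nhds_iff_ball.mp hev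
    obtain ⟨B, hBV, hB, hBne, c, hc⟩ := hloc (Metric.ball x r) (fun y hy => (hball y hy).1)
      Metric.isOpen_ball ⟨x, Metric.mem_ball_self hr⟩
    have hcF : c ∈ F := hprop B (fun y hy => (hball y (hBV hy)).1) hB hBne c hc
    obtain ⟨y, hy⟩ := hBne
    apply (hball y (hBV hy)).2
    rw [hc y hy]
    exact hcF
  obtain ⟨x, hx⟩ := hVne
  refine ⟨lam x, fun y hy => ?_, hmaps hx⟩
  exact hVc.constant_of_mapsTo hF.isDiscrete hlam hmaps hy hx
end lam

section alg
variable {ι : Type*} [Fintype ι] [DecidableEq ι]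

theorem killing_alg {R : Type*} [CommRing R] (g h A B : Matrix ι ι R) (d : R)
    (gk Γ A1 B1 : Matrix ι ι R) (lam : ι → R) (k : ι)
    (hgs : gᵀ = g) (hgh : g * h = 1) (hhg : h * g = 1)
    (hK : Bᵀ * g = g * B)
    (hAB : A * B = d • (1 : Matrix ι ι R)) (hBA : B * A = d • (1 : Matrix ι ι R))
    (h1 : gk = Γᵀ * g + g * Γ)
    (h2 : g * A1 = vecMulVec lam (g *ᵥ Pi.single k 1) + vecMulVec (g *ᵥ Pi.single k 1) lam
      + g * A * Γ - g * Γ * A)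
    (h3 : A1 * B + A * B1 = (B * A1).trace • (1 : Matrix ι ι R)) (i j : ι) :
    d * ((gk * B + g * B1) i j - (Γᵀ * (g * B) + g * B * Γ) i j)
      = 2 * (Bᵀ *ᵥ lam) k * (g * B) i j - (Bᵀ *ᵥ lam) i * (g * B) j k
        - (Bᵀ *ᵥ lam) j * (g * B) i k := by
  set γ := g *ᵥ (Pi.single k 1 : ι → R) with hγ
  set S := vecMulVec lam γ + vecMulVec γ lam with hS
  have eA1 : A1 = h * S + A * Γ - Γ * A := by
    calc A1 = h * (g * A1) := by rw [← Matrix.mul_assoc, hhg, Matrix.one_mul]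
      _ = h * S + (h * g) * A * Γ - (h * g) * Γ * A := by
          rw [h2]; noncomm_ring
      _ = _ := by rw [hhg]; simp
  have gBh : g * B * h = Bᵀ := by rw [← hK, Matrix.mul_assoc, hgh, Matrix.mul_one]
  have etr : (B * A1).trace = (B * h * S).trace := by
    have : B * A1 = B * h * S + (B * A) * Γ - B * Γ * A := by rw [eA1]; noncomm_ring
    rw [this, Matrix.trace_sub, Matrix.trace_add, Matrix.trace_mul_comm (B * Γ) A,
      ← Matrix.mul_assoc, hAB, hBA]
    ring
  have edB1 : d • B1 = (B * A1).trace • B - B * A1 * B := by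
    have : B * (A1 * B + A * B1) = (B * A1).trace • B := by rw [h3]; simp
    rw [← this, Matrix.mul_add, ← Matrix.mul_assoc, ← Matrix.mul_assoc, hBA]
    simp
  have eBAB : B * A1 * B = B * h * S * B + d • (Γ * B) - d • (B * Γ) := by
    have e : B * A1 * B = B * h * S * B + (B * A) * Γ * B - B * Γ * (A * B) := by
      rw [eA1]; noncomm_ring
    rw [e, hAB, hBA]
    simp [Matrix.mul_assoc]
  have key : d • (gk * B + g * B1) = d • (Γᵀ * (g * B) + g * B * Γ)
      + ((B * h * S).trace • (g * B) - Bᵀ * S * B) := by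
    have e2 : d • (gk * B + g * B1) = d • (gk * B) + g * (d • B1) := by
      rw [smul_add, Matrix.mul_smul]
    rw [e2, edB1, eBAB, etr, h1, ← gBh]
    simp only [Matrix.mul_sub, Matrix.mul_add, Matrix.add_mul, Matrix.mul_smul, smul_add,
      Matrix.mul_assoc]
    abel
  have ew1 : (B * h * S).trace = 2 * (Bᵀ *ᵥ lam) k := by
    have hg' : g * (B * h) = Bᵀ := by rw [← Matrix.mul_assoc, gBh]
    rw [hS, Matrix.mul_add, Matrix.trace_add, Matrix.mul_vecMulVec, Matrix.mul_vecMulVec,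
      Matrix.trace_vecMulVec, Matrix.trace_vecMulVec]
    have t1 : (B * h) *ᵥ lam ⬝ᵥ γ = (Bᵀ *ᵥ lam) k := by
      rw [dotProduct_comm, hγ, ← hgs, Matrix.mulVec_transpose, ← Matrix.dotProduct_mulVec,
        Matrix.mulVec_mulVec, hg']
      simp
    have t2 : (B * h) *ᵥ γ ⬝ᵥ lam = (Bᵀ *ᵥ lam) k := by
      rw [hγ, Matrix.mulVec_mulVec, Matrix.mul_assoc, hhg, Matrix.mul_one]
      rw [Matrix.mulVec_single_one]
      simp [Matrix.mulVec, dotProduct, Matrix.transpose_apply]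
    rw [t1, t2]; ring
  have ew2 : (Bᵀ * S * B) i j = (Bᵀ *ᵥ lam) i * (g * B) j k + (Bᵀ *ᵥ lam) j * (g * B) i k := by
    have hBγ : Bᵀ *ᵥ γ = (g * B) *ᵥ Pi.single k 1 := by
      rw [hγ, Matrix.mulVec_mulVec, hK]
    rw [hS, Matrix.mul_add, Matrix.add_mul, Matrix.mul_vecMulVec, Matrix.mul_vecMulVec,
      Matrix.vecMulVec_mul, Matrix.vecMulVec_mul, ← Matrix.mulVec_transpose,
      ← Matrix.mulVec_transpose, hBγ]
    simp [Matrix.vecMulVec_apply]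
    ring
  have := congrFun (congrFun key i) j
  simp only [Matrix.smul_apply, Matrix.add_apply, Matrix.sub_apply, smul_eq_mul, ew1, ew2] at this
  simp only [Matrix.add_apply]
  linear_combination this

theorem adj_symm {R : Type*} [CommRing R] (g h A : Matrix ι ι R) (hgs : gᵀ = g)
    (hgh : g * h = 1) (hhg : h * g = 1) (hA : Aᵀ * g = g * A) :
    (A.adjugate)ᵀ * g = g * A.adjugate := by
  have e := congrArg Matrix.adjugate hA
  rw [Matrix.adjugate_mul_distrib, Matrix.adjugate_mul_distrib, ← Matrix.adjugate_transpose] at e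
  have hdu : IsUnit g.det := by
    apply IsUnit.of_mul_eq_one h.det
    rw [← Matrix.det_mul, hgh, Matrix.det_one]
  have e2 : g * (g.adjugate * A.adjugateᵀ) * g = g * (A.adjugate * g.adjugate) * g := by rw [e]
  rw [← Matrix.mul_assoc, Matrix.mul_adjugate, Matrix.mul_assoc g, Matrix.mul_assoc A.adjugate,
    Matrix.adjugate_mul] at e2
  simp only [Matrix.smul_mul, Matrix.one_mul, Matrix.mul_smul, Matrix.mul_one] at e2
  exact hdu.smul_left_cancel.mp e2
end alg

section calc1
variable {ι : Type*} [Fintype ι] [DecidableEq ι] {U : Set (ι → ℝ)}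

/-- coefficientwise partial derivative -/
def HP (k : ι) (x : ι → ℝ) (f : (ι → ℝ) → ℝ[X]) (f' : ℝ[X]) : Prop :=
  ∀ a, DifferentiableAt ℝ (fun y => (f y).coeff a) x ∧ pd k (fun y => (f y).coeff a) x = f'.coeff a

theorem HP.const (k : ι) (x : ι → ℝ) (p : ℝ[X]) : HP k x (fun _ => p) 0 := fun a =>
  ⟨differentiableAt_const _, by simp [pd]⟩

theorem HP.C {k : ι} {x : ι → ℝ} {f : (ι → ℝ) → ℝ} (hf : DifferentiableAt ℝ f x) :
    HP k x (fun y => Polynomial.C (f y)) (Polynomial.C (pd k f x)) := by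
  intro a
  by_cases ha : a = 0
  · subst ha
    simp only [coeff_C_zero]
    exact ⟨hf, trivial⟩
  · simp only [coeff_C_of_ne_zero ha]
    exact ⟨differentiableAt_const _, by simp [pd]⟩

theorem HP.add {k : ι} {x : ι → ℝ} {f g : (ι → ℝ) → ℝ[X]} {f' g' : ℝ[X]} (hf : HP k x f f')
    (hg : HP k x g g') : HP k x (fun y => f y + g y) (f' + g') := by
  intro a
  simp only [coeff_add]
  exact ⟨(hf a).1.add (hg a).1, by rw [pd_add (hf a).1 (hg a).1, (hf a).2, (hg a).2]⟩

theorem HP.sum {k : ι} {x : ι → ℝ} {α : Type*} (s : Finset α) {f : α → (ι → ℝ) → ℝ[X]}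
    {f' : α → ℝ[X]} (hf : ∀ i ∈ s, HP k x (f i) (f' i)) :
    HP k x (fun y => ∑ i ∈ s, f i y) (∑ i ∈ s, f' i) := by
  classical
  induction s using Finset.induction_on with
  | empty => simpa using HP.const k x 0
  | insert a s ha ih =>
    simp only [Finset.sum_insert ha]
    exact (hf a (by simp)).add (ih fun i hi => hf i (by simp [hi]))

theorem HP.mul {k : ι} {x : ι → ℝ} {f g : (ι → ℝ) → ℝ[X]} {f' g' : ℝ[X]} (hf : HP k x f f')
    (hg : HP k x g g') : HP k x (fun y => f y * g y) (f' * g x + f x * g') := by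
  intro a
  simp only [coeff_mul, coeff_add]
  have hd : ∀ p ∈ Finset.HasAntidiagonal.antidiagonal a,
      DifferentiableAt ℝ (fun y => (f y).coeff p.1 * (g y).coeff p.2) x :=
    fun p _ => (hf p.1).1.mul (hg p.2).1
  refine ⟨DifferentiableAt.fun_sum hd, ?_⟩
  rw [pd_sum _ hd, ← Finset.sum_add_distrib]
  refine Finset.sum_congr rfl fun p _ => ?_
  rw [pd_mul (hf p.1).1 (hg p.2).1, (hf p.1).2, (hg p.2).2]

theorem HP.prod {k : ι} {x : ι → ℝ} {α : Type*} [DecidableEq α] (s : Finset α)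
    {f : α → (ι → ℝ) → ℝ[X]} {f' : α → ℝ[X]} (hf : ∀ i, HP k x (f i) (f' i)) :
    HP k x (fun y => ∏ i ∈ s, f i y) (∑ i ∈ s, ∏ j ∈ s, if j = i then f' j else f j x) := by
  induction s using Finset.induction_on with
  | empty => simpa using HP.const k x 1
  | insert a s ha ih =>
    have := (hf a).mul ih
    simp only [Finset.prod_insert ha, Finset.sum_insert ha]
    convert this using 1
    congr 1
    · simp only [if_true]
      congr 1
      refine Finset.prod_congr rfl fun j hj => ?_
      rw [if_neg]
      rintro rfl; exact ha hj
    · rw [Finset.mul_sum]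
      refine Finset.sum_congr rfl fun i hi => ?_
      rw [if_neg]
      rintro rfl; exact ha hi

theorem HP.det {k : ι} {x : ι → ℝ} {A : (ι → ℝ) → Matrix ι ι ℝ[X]} {A' : Matrix ι ι ℝ[X]}
    (hA : ∀ i j, HP k x (fun y => A y i j) (A' i j)) :
    HP k x (fun y => (A y).det) ((A x).adjugate * A').trace := by
  have h1 : HP k x (fun y => ∑ σ : Equiv.Perm ι,
      ((Equiv.Perm.sign σ : ℤ) : ℝ[X]) * ∏ i, A y (σ i) i) (∑ σ : Equiv.Perm ι,
      (0 * (∏ i, A x (σ i) i) + ((Equiv.Perm.sign σ : ℤ) : ℝ[X]) *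
        ∑ i, ∏ j, if j = i then A' (σ j) j else A x (σ j) j)) := by
    refine HP.sum _ fun σ _ => ?_
    exact (HP.const k x _).mul (HP.prod (f' := fun j => A' (σ j) j) Finset.univ
      (fun i => hA (σ i) i))
  simp only [Matrix.det_apply']
  convert h1 using 1
  have e : ∀ i, ((A x).adjugate * A') i i = ((A x).updateCol i (fun m => A' m i)).det := by
    intro i
    rw [← Matrix.cramer_apply, Matrix.cramer_eq_adjugate_mulVec]
    rfl
  simp only [Matrix.trace, Matrix.diag_apply, e, Matrix.det_apply', zero_mul, zero_add,
    Finset.mul_sum]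
  rw [Finset.sum_comm]
  refine Finset.sum_congr rfl fun σ _ => Finset.sum_congr rfl fun i _ => ?_
  congr 1
  refine Finset.prod_congr rfl fun j _ => ?_
  by_cases hj : j = i
  · subst hj; simp
  · simp [hj]

theorem HP.adj {k : ι} {x : ι → ℝ} {A : (ι → ℝ) → Matrix ι ι ℝ[X]} {A' : Matrix ι ι ℝ[X]}
    (hA : ∀ i j, HP k x (fun y => A y i j) (A' i j)) :
    ∃ B' : Matrix ι ι ℝ[X], ∀ i j, HP k x (fun y => (A y).adjugate i j) (B' i j) := by
  have : ∀ i j, ∃ b, HP k x (fun y => (A y).adjugate i j) b := by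
    intro i j
    simp only [Matrix.adjugate_apply]
    refine ⟨_, HP.det (A' := A'.updateRow j 0) fun p q => ?_⟩
    by_cases hp : p = j
    · subst hp
      simpa using HP.const k x _
    · simpa [Matrix.updateRow_ne hp] using hA p q
  choose b hb using this
  exact ⟨b, hb⟩

theorem HP.unique {k : ι} {x : ι → ℝ} {f : (ι → ℝ) → ℝ[X]} {f' f₁ : ℝ[X]} (hf : HP k x f f')
    (hf' : HP k x f f₁) : f' = f₁ := by
  ext a
  rw [← (hf a).2, ← (hf' a).2]

theorem HP.matmul {k : ι} {x : ι → ℝ} {A B : (ι → ℝ) → Matrix ι ι ℝ[X]} {A' B' : Matrix ι ι ℝ[X]}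
    (hA : ∀ i j, HP k x (fun y => A y i j) (A' i j))
    (hB : ∀ i j, HP k x (fun y => B y i j) (B' i j)) (i j : ι) :
    HP k x (fun y => (A y * B y) i j) ((A' * B x + A x * B') i j) := by
  simp only [Matrix.add_apply, Matrix.mul_apply, ← Finset.sum_add_distrib]
  exact HP.sum _ fun l _ => (hA i l).mul (hB l j)

/-- coefficientwise smoothness -/
def CP (U : Set (ι → ℝ)) (f : (ι → ℝ) → ℝ[X]) : Prop :=
  ∀ a, ContDiffOn ℝ (⊤ : ℕ∞) (fun y => (f y).coeff a) U

theorem CP.const (p : ℝ[X]) : CP U (fun _ => p) := fun a => contDiffOn_const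

theorem CP.C {f : (ι → ℝ) → ℝ} (hf : ContDiffOn ℝ (⊤ : ℕ∞) f U) :
    CP U (fun y => Polynomial.C (f y)) := by
  intro a
  by_cases ha : a = 0
  · subst ha
    simpa only [coeff_C_zero] using hf
  · simpa only [coeff_C_of_ne_zero ha] using contDiffOn_const

theorem CP.add {f g : (ι → ℝ) → ℝ[X]} (hf : CP U f) (hg : CP U g) :
    CP U (fun y => f y + g y) := by
  intro a
  simp only [coeff_add]
  exact (hf a).add (hg a)

theorem CP.mul {f g : (ι → ℝ) → ℝ[X]} (hf : CP U f) (hg : CP U g) :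
    CP U (fun y => f y * g y) := by
  intro a
  simp only [coeff_mul]
  exact ContDiffOn.sum fun p _ => (hf p.1).mul (hg p.2)

theorem CP.sum {α : Type*} (s : Finset α) {f : α → (ι → ℝ) → ℝ[X]} (hf : ∀ i, CP U (f i)) :
    CP U (fun y => ∑ i ∈ s, f i y) := by
  intro a
  simp only [finsetSum_coeff]
  exact ContDiffOn.sum fun p _ => hf p a

theorem CP.prod {α : Type*} (s : Finset α) {f : α → (ι → ℝ) → ℝ[X]} (hf : ∀ i, CP U (f i)) :
    CP U (fun y => ∏ i ∈ s, f i y) := by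
  classical
  induction s using Finset.induction_on with
  | empty => simpa using CP.const 1
  | insert a s ha ih =>
    simp only [Finset.prod_insert ha]
    exact (hf a).mul ih

theorem CP.det {A : (ι → ℝ) → Matrix ι ι ℝ[X]} (hA : ∀ i j, CP U (fun y => A y i j)) :
    CP U (fun y => (A y).det) := by
  simp only [Matrix.det_apply']
  exact CP.sum _ fun σ => (CP.const _).mul (CP.prod _ fun i => hA _ _)

theorem CP.adj {A : (ι → ℝ) → Matrix ι ι ℝ[X]} (hA : ∀ i j, CP U (fun y => A y i j)) (i j : ι) :
    CP U (fun y => (A y).adjugate i j) := by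
  simp only [Matrix.adjugate_apply]
  refine CP.det fun p q => ?_
  by_cases hp : p = j
  · subst hp
    simpa using CP.const _
  · simpa [Matrix.updateRow_ne hp] using hA p q

theorem inv_smooth {g : (ι → ℝ) → Matrix ι ι ℝ}
    (hg : ∀ i j, ContDiffOn ℝ (⊤ : ℕ∞) (fun y => g y i j) U) (hdet : ∀ x ∈ U, IsUnit (g x).det)
    (i j : ι) : ContDiffOn ℝ (⊤ : ℕ∞) (fun y => (g y)⁻¹ i j) U := by
  have h1 : ∀ i j, CP U (fun y => (g y).map Polynomial.C i j) := fun i j => CP.C (hg i j)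
  have h2 : ContDiffOn ℝ (⊤ : ℕ∞) (fun y => (g y).det) U := by
    have := CP.det h1 0
    refine this.congr fun y _ => ?_
    have e : ((g y).map Polynomial.C).det = Polynomial.C (g y).det :=
      (RingHom.map_det Polynomial.C (g y)).symm
    simp only [e, coeff_C_zero]
  have h3 : ContDiffOn ℝ (⊤ : ℕ∞) (fun y => (g y).adjugate i j) U := by
    have := CP.adj h1 i j 0
    refine this.congr fun y _ => ?_
    have e : ((g y).map Polynomial.C).adjugate = (g y).adjugate.map Polynomial.C :=
      (RingHom.map_adjugate Polynomial.C (g y)).symm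
    simp only [e, Matrix.map_apply, coeff_C_zero]
  refine ((h2.inv fun y hy => (hdet y hy).ne_zero).mul h3).congr fun y hy => ?_
  simp [Matrix.inv_def]

theorem christoffel_smooth (hU : IsOpen U) {g : (ι → ℝ) → Matrix ι ι ℝ}
    (hg : ∀ i j, ContDiffOn ℝ (⊤ : ℕ∞) (fun y => g y i j) U) (hdet : ∀ x ∈ U, IsUnit (g x).det)
    (l j k : ι) : ContDiffOn ℝ (⊤ : ℕ∞) (fun x => christoffel g x l j k) U := by
  unfold christoffel
  exact contDiffOn_const.mul (ContDiffOn.sum fun m _ => (inv_smooth hg hdet l m).mul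
    (((pd_smooth hU (hg _ _) _).add (pd_smooth hU (hg _ _) _)).sub (pd_smooth hU (hg _ _) _)))

theorem natDegree_det_le' {A : Matrix ι ι ℝ[X]} (hA : ∀ i j, (A i j).natDegree ≤ 1) :
    A.det.natDegree ≤ Fintype.card ι := by
  rw [Matrix.det_apply]
  refine natDegree_sum_le_of_forall_le _ _ fun σ _ => ?_
  refine (natDegree_smul_le _ _).trans ?_
  refine (natDegree_prod_le _ _).trans ?_
  refine (Finset.sum_le_card_nsmul _ _ 1 fun i _ => hA _ _).trans ?_
  simp

theorem natDegree_adj_le' {A : Matrix ι ι ℝ[X]} (hA : ∀ i j, (A i j).natDegree ≤ 1) (i j : ι) :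
    (A.adjugate i j).natDegree ≤ Fintype.card ι := by
  rw [Matrix.adjugate_apply]
  refine natDegree_det_le' fun p q => ?_
  by_cases hp : p = j
  · subst hp
    rw [Matrix.updateRow_self]
    by_cases hq : q = i
    · subst hq; simp
    · simp [hq]
  · rw [Matrix.updateRow_ne hp]; exact hA p q

end calc1

section geom
variable {ι : Type*} [Fintype ι] [DecidableEq ι] {U : Set (ι → ℝ)}

theorem christoffel_lower {g : (ι → ℝ) → Matrix ι ι ℝ} {x : ι → ℝ} (hdet : IsUnit (g x).det)
    (i k j : ι) : ∑ l, g x i l * christoffel g x l k j = (1/2) *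
    (pd k (fun y => g y i j) x + pd j (fun y => g y i k) x - pd i (fun y => g y k j) x) := by
  set v : ι → ℝ := fun m =>
    pd k (fun y => g y m j) x + pd j (fun y => g y m k) x - pd m (fun y => g y k j) x with hv
  have e : ∀ l, christoffel g x l k j = (1/2) * ((g x)⁻¹ *ᵥ v) l := fun l => rfl
  have e2 : g x *ᵥ ((g x)⁻¹ *ᵥ v) = v := by
    rw [Matrix.mulVec_mulVec, Matrix.mul_nonsing_inv _ hdet, Matrix.one_mulVec]
  have e3 : ∑ l, g x i l * ((g x)⁻¹ *ᵥ v) l = v i := congrFun e2 i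
  simp only [e]
  rw [show (1/2 : ℝ) * (pd k (fun y => g y i j) x + pd j (fun y => g y i k) x
    - pd i (fun y => g y k j) x) = (1/2) * v i from rfl, ← e3, Finset.mul_sum]
  exact Finset.sum_congr rfl fun l _ => by ring

/-- the matrix of Christoffel symbols in direction k -/
noncomputable def chM (g : (ι → ℝ) → Matrix ι ι ℝ) (x : ι → ℝ) (k : ι) : Matrix ι ι ℝ :=
  Matrix.of fun l i => christoffel g x l k i

/-- the entrywise partial derivative of a matrix -/
noncomputable def pdM (g : (ι → ℝ) → Matrix ι ι ℝ) (x : ι → ℝ) (k : ι) : Matrix ι ι ℝ :=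
  Matrix.of fun i j => pd k (fun y => g y i j) x

theorem metric_compat (hU : IsOpen U) {g : (ι → ℝ) → Matrix ι ι ℝ}
    (hs : ∀ x ∈ U, (g x).IsSymm) {x : ι → ℝ} (hx : x ∈ U) (hdet : IsUnit (g x).det) (k : ι) :
    pdM g x k = (chM g x k)ᵀ * g x + g x * chM g x k := by
  have hsw : ∀ a i j, pd a (fun y => g y i j) x = pd a (fun y => g y j i) x := fun a i j =>
    pd_congr hU (fun y hy => (hs y hy).apply j i) a x hx
  ext i j
  have e1 : ((chM g x k)ᵀ * g x) i j = ∑ l, g x j l * christoffel g x l k i := by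
    rw [Matrix.mul_apply]
    refine Finset.sum_congr rfl fun l _ => ?_
    rw [Matrix.transpose_apply, (hs x hx).apply j l, mul_comm]; rfl
  have e2 : (g x * chM g x k) i j = ∑ l, g x i l * christoffel g x l k j := rfl
  rw [Matrix.add_apply, e1, e2, christoffel_lower hdet, christoffel_lower hdet]
  change pd k (fun y => g y i j) x = _
  rw [hsw k j i, hsw j k i, hsw i k j]
  ring

theorem compat_deriv (hU : IsOpen U) {g L : (ι → ℝ) → Matrix ι ι ℝ} (h : IsCompatiblePair U g L)
    {x : ι → ℝ} (hx : x ∈ U) (k : ι) :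
    g x * pdM L x k = vecMulVec (fun i => pd i (fun y => (1/2) * (L y).trace) x)
        (g x *ᵥ Pi.single k 1)
      + vecMulVec (g x *ᵥ Pi.single k 1) (fun i => pd i (fun y => (1/2) * (L y).trace) x)
      + g x * L x * chM g x k - g x * chM g x k * L x := by
  obtain ⟨hg, hL, hs, hc⟩ := h
  have hmc := metric_compat hU (fun y hy => (hs y hy).1) hx (hs x hx).2.1 k
  have hprod : Matrix.of (fun i j => pd k (fun y => (g y * L y) i j) x)
      = pdM g x k * L x + g x * pdM L x k := by
    ext i j
    simp only [Matrix.of_apply, Matrix.add_apply, Matrix.mul_apply]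
    rw [← Finset.sum_add_distrib]
    refine (pd_sum (f := fun l y => g y i l * L y l j) Finset.univ
      (fun l _ => (sm_diffAt hU (hg i l) hx).mul (sm_diffAt hU (hL l j) hx)) k).trans ?_
    exact Finset.sum_congr rfl fun l _ =>
      pd_mul (sm_diffAt hU (hg i l) hx) (sm_diffAt hU (hL l j) hx) k
  have hcm : Matrix.of (fun i j => pd k (fun y => (g y * L y) i j) x)
      - (chM g x k)ᵀ * (g x * L x) - g x * L x * chM g x k
      = vecMulVec (fun i => pd i (fun y => (1/2) * (L y).trace) x) (g x *ᵥ Pi.single k 1)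
      + vecMulVec (g x *ᵥ Pi.single k 1)
        (fun i => pd i (fun y => (1/2) * (L y).trace) x) := by
    ext i j
    have e1 : ((chM g x k)ᵀ * (g x * L x)) i j
      = ∑ l, christoffel g x l k i * (g x * L x) l j := rfl
    have e2 : (g x * L x * chM g x k) i j = ∑ l, christoffel g x l k j * (g x * L x) i l := by
      rw [Matrix.mul_apply]
      exact Finset.sum_congr rfl fun l _ => mul_comm _ _
    have := hc x hx i j k
    rw [Matrix.sub_apply, Matrix.sub_apply, e1, e2, Matrix.of_apply, this, Matrix.add_apply,
      Matrix.vecMulVec_apply, Matrix.vecMulVec_apply, Matrix.mulVec_single_one]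
    simp only [Matrix.col_apply]
    ring
  rw [← hcm, hprod, hmc]
  noncomm_ring

/-- the polynomial family of Killing tensors -/
noncomputable def PP (g L : (ι → ℝ) → Matrix ι ι ℝ) (y : ι → ℝ) : Matrix ι ι ℝ[X] :=
  (g y).map Polynomial.C * (charmatrix (L y)).adjugate

theorem charmatrix_eq (M : Matrix ι ι ℝ) :
    charmatrix M = (X : ℝ[X]) • (1 : Matrix ι ι ℝ[X]) - M.map Polynomial.C := by
  ext1 i j
  by_cases hij : i = j
  · subst hij
    simp [charmatrix_apply_eq]
  · simp [charmatrix_apply_ne _ _ _ hij, hij]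

theorem gA_symm {g L : Matrix ι ι ℝ} (hg : g.IsSymm) (hgL : (g * L).IsSymm) :
    (charmatrix L)ᵀ * g.map Polynomial.C = g.map Polynomial.C * charmatrix L := by
  have e : Lᵀ * g = g * L := by
    have := hgL.eq
    rwa [Matrix.transpose_mul, hg.eq] at this
  have e' : (L.map Polynomial.C)ᵀ * g.map Polynomial.C = g.map Polynomial.C * L.map Polynomial.C := by
    rw [← Matrix.transpose_map, ← Matrix.map_mul, ← Matrix.map_mul, e]
  rw [charmatrix_eq, Matrix.transpose_sub, Matrix.sub_mul, e', Matrix.mul_sub]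
  simp

theorem PP_symm {g L : (ι → ℝ) → Matrix ι ι ℝ} {x : ι → ℝ} (hg : (g x).IsSymm)
    (hgL : (g x * L x).IsSymm) (hdet : IsUnit (g x).det) (i j : ι) :
    PP g L x i j = PP g L x j i := by
  have hgh : (g x).map Polynomial.C * ((g x)⁻¹).map Polynomial.C = 1 := by
    rw [← Matrix.map_mul, Matrix.mul_nonsing_inv _ hdet]; simp
  have hhg : ((g x)⁻¹).map Polynomial.C * (g x).map Polynomial.C = 1 := by
    rw [← Matrix.map_mul, Matrix.nonsing_inv_mul _ hdet]; simp
  have hgs : ((g x).map Polynomial.C)ᵀ = (g x).map Polynomial.C := by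
    rw [← Matrix.transpose_map, hg.eq]
  have := adj_symm _ _ _ hgs hgh hhg (gA_symm hg hgL)
  unfold PP
  rw [← this, ← Matrix.transpose_apply (_ * _) j i, Matrix.transpose_mul,
    Matrix.transpose_transpose, hgs, this]

theorem PP_killing (hU : IsOpen U) {g L : (ι → ℝ) → Matrix ι ι ℝ} (h : IsCompatiblePair U g L)
    (a : ℕ) : Killing U (fun l k i x => christoffel g x l k i)
      (fun i j y => (PP g L y i j).coeff a) := by
  have h' := h
  obtain ⟨hg, hL, hs, hc⟩ := h'
  intro x hx
  obtain ⟨hgs0, hdet, -, hgL⟩ := hs x hx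
  set G := (g x).map Polynomial.C with hG
  set A := charmatrix (L x) with hA
  set B := A.adjugate with hB
  have hgh : G * ((g x)⁻¹).map Polynomial.C = 1 := by
    rw [hG, ← Matrix.map_mul, Matrix.mul_nonsing_inv _ hdet]; simp
  have hhg : ((g x)⁻¹).map Polynomial.C * G = 1 := by
    rw [hG, ← Matrix.map_mul, Matrix.nonsing_inv_mul _ hdet]; simp
  have hgs : Gᵀ = G := by
    rw [hG, ← Matrix.transpose_map, hgs0.eq]
  have hK : Bᵀ * G = G * B := adj_symm _ _ _ hgs hgh hhg (gA_symm hgs0 hgL)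
  set lam : ι → ℝ[X] := fun i => - Polynomial.C (pd i (fun y => (1/2) * (L y).trace) x) with hlam
  -- derivative data in direction k
  have main : ∀ k, ∃ D : Matrix ι ι ℝ[X], (∀ i j, HP k x (fun y => PP g L y i j) (D i j)) ∧
      ∀ i j, A.det * (D i j - (((chM g x k).map Polynomial.C)ᵀ * (G * B)
        + G * B * (chM g x k).map Polynomial.C) i j)
      = 2 * (Bᵀ *ᵥ lam) k * (G * B) i j - (Bᵀ *ᵥ lam) i * (G * B) j k
        - (Bᵀ *ᵥ lam) j * (G * B) i k := by
    intro k
    have hGk : ∀ i j, HP k x (fun y => (g y).map Polynomial.C i j) ((pdM g x k).map Polynomial.C i j) :=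
      fun i j => HP.C (sm_diffAt hU (hg i j) hx)
    have hAk : ∀ i j, HP k x (fun y => charmatrix (L y) i j)
        ((-(pdM L x k).map Polynomial.C) i j) := by
      intro i j
      have h1 := (HP.const k x (((X : ℝ[X]) • (1 : Matrix ι ι ℝ[X])) i j)).add
        ((HP.const k x (-1)).mul (HP.C (k := k) (sm_diffAt hU (hL i j) hx)))
      have e1 : (fun y => ((X : ℝ[X]) • (1 : Matrix ι ι ℝ[X])) i j + -1 * Polynomial.C (L y i j))
          = (fun y => charmatrix (L y) i j) := by
        funext y
        rw [charmatrix_eq, Matrix.sub_apply, Matrix.map_apply]; ring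
      rw [e1] at h1
      convert h1 using 1
      simp [pdM]
    obtain ⟨B1, hB1⟩ := HP.adj hAk
    refine ⟨_, HP.matmul hGk hB1, ?_⟩
    refine killing_alg G (((g x)⁻¹).map Polynomial.C) A B A.det ((pdM g x k).map Polynomial.C)
      ((chM g x k).map Polynomial.C) (-(pdM L x k).map Polynomial.C) B1 lam k hgs hgh hhg hK
      (Matrix.mul_adjugate A) (Matrix.adjugate_mul A) ?_ ?_ ?_
    · rw [metric_compat hU (fun y hy => (hs y hy).1) hx hdet k, hG, ← Matrix.transpose_map,
        ← Matrix.map_mul, ← Matrix.map_mul, Matrix.map_add _ (by simp)]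
    · have e := congrArg (fun M : Matrix ι ι ℝ => M.map (Polynomial.C : ℝ →+* ℝ[X]))
        (compat_deriv hU h hx k)
      have v1 : ∀ u : ι → ℝ, (vecMulVec u (g x *ᵥ Pi.single k 1)).map (Polynomial.C : ℝ →+* ℝ[X])
          = vecMulVec (fun i => Polynomial.C (u i)) (G *ᵥ Pi.single k 1) := by
        intro u
        ext1 p q
        simp [Matrix.vecMulVec_apply, hG, Matrix.mulVec_single_one]
      have v2 : ∀ u : ι → ℝ, (vecMulVec (g x *ᵥ Pi.single k 1) u).map (Polynomial.C : ℝ →+* ℝ[X])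
          = vecMulVec (G *ᵥ Pi.single k 1) (fun i => Polynomial.C (u i)) := by
        intro u
        ext1 p q
        simp [Matrix.vecMulVec_apply, hG, Matrix.mulVec_single_one]
      simp only [Matrix.map_sub _ (map_sub (Polynomial.C : ℝ →+* ℝ[X])),
        Matrix.map_add _ (map_add (Polynomial.C : ℝ →+* ℝ[X])), Matrix.map_mul, v1, v2] at e
      rw [← hG] at e
      have hl : lam = -(fun i => Polynomial.C (pd i (fun y => (1/2) * (L y).trace) x)) := rfl
      rw [Matrix.mul_neg, e, hl, Matrix.neg_vecMulVec, Matrix.vecMulVec_neg, hA, charmatrix_eq]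
      simp only [Matrix.mul_sub, Matrix.sub_mul, Matrix.mul_smul, Matrix.smul_mul, Matrix.mul_one]
      abel
    · ext i j : 2
      have e1 := HP.matmul hAk hB1 i j
      simp only [Matrix.mul_adjugate] at e1
      have e2 : HP k x (fun y => ((charmatrix (L y)).det • (1 : Matrix ι ι ℝ[X])) i j)
          ((B * -(pdM L x k).map Polynomial.C).trace * (1 : Matrix ι ι ℝ[X]) i j
            + A.det * 0) := (HP.det hAk).mul (HP.const k x _)
      have := HP.unique e1 e2
      rw [this]
      simp
  choose D hD hDe using main
  intro k i j
  have hsym : ∀ i j, (G * B) i j = (G * B) j i := fun i j => PP_symm hgs0 hgL hdet i j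
  have hd : A.det ≠ 0 := (Matrix.charpoly_monic (L x)).ne_zero
  have hsum : D k i j + D i j k + D j k i
      = (((chM g x k).map Polynomial.C)ᵀ * (G * B) + G * B * (chM g x k).map Polynomial.C) i j
      + (((chM g x i).map Polynomial.C)ᵀ * (G * B) + G * B * (chM g x i).map Polynomial.C) j k
      + (((chM g x j).map Polynomial.C)ᵀ * (G * B) + G * B * (chM g x j).map Polynomial.C) k i := by
    apply mul_left_cancel₀ hd
    have a1 := hDe k i j
    have a2 := hDe i j k
    have a3 := hDe j k i
    rw [hsym j i] at a2
    rw [hsym k i, hsym k j] at *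
    linear_combination a1 + a2 + a3
  have hRK : ∀ k i j, ((((chM g x k).map Polynomial.C)ᵀ * (G * B)
      + G * B * (chM g x k).map Polynomial.C) i j).coeff a
      = RK (fun l k i x => christoffel g x l k i) (fun i j y => (PP g L y i j).coeff a) k i j x := by
    intro k i j
    rw [Matrix.add_apply, Matrix.mul_apply, Matrix.mul_apply (N := (chM g x k).map Polynomial.C),
      ← Finset.sum_add_distrib, Polynomial.finsetSum_coeff, RK]
    refine Finset.sum_congr rfl fun l _ => ?_
    simp only [Matrix.transpose_apply, Matrix.map_apply, coeff_add, coeff_C_mul, coeff_mul_C]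
    rw [mul_comm (((G * B) i l).coeff a)]
    rfl
  rw [(hD k i j a).2, (hD i j k a).2, (hD j k i a).2, ← coeff_add, ← coeff_add, hsum, coeff_add,
    coeff_add, hRK, hRK, hRK]

theorem PP_smooth {g L : (ι → ℝ) → Matrix ι ι ℝ}
    (hg : ∀ i j, ContDiffOn ℝ (⊤ : ℕ∞) (fun y => g y i j) U)
    (hL : ∀ i j, ContDiffOn ℝ (⊤ : ℕ∞) (fun y => L y i j) U) (i j : ι) :
    CP U (fun y => PP g L y i j) := by
  have hA : ∀ i j, CP U (fun y => charmatrix (L y) i j) := by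
    intro i j
    have := (CP.const (U := U) (((X : ℝ[X]) • (1 : Matrix ι ι ℝ[X])) i j)).add
      ((CP.const (-1)).mul (CP.C (hL i j)))
    refine (congrArg (CP U) (funext fun y => ?_)).mp this
    rw [charmatrix_eq, Matrix.sub_apply, Matrix.map_apply]; ring
  simp only [PP, Matrix.mul_apply]
  exact CP.sum _ fun l => (CP.C (hg i l)).mul (CP.adj hA l j)

theorem PP_degree (g L : (ι → ℝ) → Matrix ι ι ℝ) (y : ι → ℝ) (i j : ι) :
    (PP g L y i j).natDegree < Fintype.card ι + 1 := by
  rw [Nat.lt_succ_iff, PP, Matrix.mul_apply]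
  refine natDegree_sum_le_of_forall_le _ _ fun l _ => ?_
  rw [Matrix.map_apply]
  refine (natDegree_C_mul_le _ _).trans (natDegree_adj_le' (fun p q => ?_) l j)
  by_cases hpq : p = q
  · subst hpq
    rw [charmatrix_apply_eq]
    simp
  · rw [charmatrix_apply_ne _ _ _ hpq]
    simp

theorem PP_ne [Nonempty ι] {g L : (ι → ℝ) → Matrix ι ι ℝ} {x : ι → ℝ} (hdet : IsUnit (g x).det) :
    ∃ i j, PP g L x i j ≠ 0 := by
  by_contra hcon
  push Not at hcon
  have h0 : PP g L x = 0 := by ext1 i j; exact hcon i j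
  have hhg : ((g x)⁻¹).map Polynomial.C * (g x).map Polynomial.C = 1 := by
    rw [← Matrix.map_mul, Matrix.nonsing_inv_mul _ hdet]; simp
  have h1 : (charmatrix (L x)).adjugate = 0 := by
    rw [← Matrix.one_mul (charmatrix (L x)).adjugate, ← hhg, Matrix.mul_assoc]
    change _ * PP g L x = 0
    rw [h0, Matrix.mul_zero]
  have h2 := Matrix.mul_adjugate (charmatrix (L x))
  rw [h1, Matrix.mul_zero] at h2
  obtain ⟨i⟩ := ‹Nonempty ι›
  have h3 := congrFun (congrFun h2 i) i
  simp at h3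
  exact (Matrix.charpoly_monic (L x)).ne_zero h3.symm

theorem PP_aeval (g L : (ι → ℝ) → Matrix ι ι ℝ) (x : ι → ℝ) (z : ℂ) :
    (PP g L x).map (aeval z) = (g x).map (algebraMap ℝ ℂ) *
      (z • (1 : Matrix ι ι ℂ) - (L x).map (algebraMap ℝ ℂ)).adjugate := by
  have e1 : ((charmatrix (L x)).adjugate).map (aeval z : ℝ[X] →ₐ[ℝ] ℂ)
      = ((charmatrix (L x)).map (aeval z : ℝ[X] →ₐ[ℝ] ℂ)).adjugate :=
    RingHom.map_adjugate (aeval z : ℝ[X] →ₐ[ℝ] ℂ).toRingHom _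
  rw [PP, Matrix.map_mul, e1]
  have e2 : ((g x).map Polynomial.C).map (aeval z : ℝ[X] →ₐ[ℝ] ℂ)
      = (g x).map (algebraMap ℝ ℂ) := by
    ext i j; simp
  have e3 : (charmatrix (L x)).map (aeval z : ℝ[X] →ₐ[ℝ] ℂ)
      = z • (1 : Matrix ι ι ℂ) - (L x).map (algebraMap ℝ ℂ) := by
    ext i j
    rw [charmatrix_eq]
    by_cases hij : i = j
    · subst hij; simp
    · simp [hij]
  rw [e2, e3]

theorem adj_neg_zero {M : Matrix ι ι ℂ} (h : M.adjugate = 0) : (-M).adjugate = 0 := by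
  rw [← neg_one_smul ℂ M, Matrix.adjugate_smul, h, smul_zero]

end geom

/-- propagation of eigenvalues of high geometric multiplicity. -/
theorem eigenvalue_propagation
    {n : ℕ} (U : Set (Fin n → ℝ)) (hU : IsOpen U) (hUconn : IsConnected U)
    (g L : (Fin n → ℝ) → Matrix (Fin n) (Fin n) ℝ)
    (hcomp : IsCompatiblePair U g L)
    (V : Set (Fin n → ℝ)) (hVU : V ⊆ U) (hVne : V.Nonempty)
    (hVopen : IsOpen V) (hVconn : IsConnected V)
    (lam : (Fin n → ℝ) → ℂ) (hcont : ContinuousOn lam V)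
    (hdich : (∀ x ∈ V, (lam x).im = 0) ∨ (∀ x ∈ V, (lam x).im ≠ 0))
    (heig : ∀ x ∈ V, lam x ∈ spectrum ℂ ((L x).map (algebraMap ℝ ℂ)) ∧
      2 ≤ Module.finrank ℂ
        (LinearMap.ker (Matrix.mulVecLin ((L x).map (algebraMap ℝ ℂ) - lam x • 1)))) :
    ∃ c : ℂ, (∀ x ∈ V, lam x = c) ∧
      ∀ x ∈ U, c ∈ spectrum ℂ ((L x).map (algebraMap ℝ ℂ)) ∧
        2 ≤ Module.finrank ℂ
          (LinearMap.ker (Matrix.mulVecLin ((L x).map (algebraMap ℝ ℂ) - c • 1))) := by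
  obtain ⟨hg, hL, hs, hc⟩ := id hcomp
  have hn : 0 < n := by
    obtain ⟨x, hx⟩ := hVne
    have h1 := (heig x hx).2
    have h2 := Submodule.finrank_le
      (LinearMap.ker (Matrix.mulVecLin ((L x).map (algebraMap ℝ ℂ) - lam x • 1)))
    rw [Module.finrank_fin_fun] at h2
    omega
  haveI : Nonempty (Fin n) := ⟨⟨0, hn⟩⟩
  have hz : ∀ x ∈ V, ∀ i j, aeval (lam x) (PP g L x i j) = 0 := by
    intro x hx i j
    have h1 := adj_neg_zero (adj_zero_of_ker _ (heig x hx).2)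
    rw [neg_sub] at h1
    have h2 := PP_aeval g L x (lam x)
    rw [h1, Matrix.mul_zero] at h2
    exact congrFun (congrFun h2 i) j
  obtain ⟨c, hcV, hcU⟩ := lam_main hU hUconn.isPreconnected
    (N := Fintype.card (Fin n) + 1) (P := fun y i j => PP g L y i j)
    (Γ := fun l k i x => christoffel g x l k i)
    (fun l k i => christoffel_smooth hU hg (fun x hx => (hs x hx).2.1) l k i)
    (fun y i j => PP_degree g L y i j)
    (fun a i j => PP_smooth hg hL i j a)
    (fun x hx i j => PP_symm (hs x hx).1 (hs x hx).2.2.2 (hs x hx).2.1 i j)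
    (fun a => PP_killing hU hcomp a)
    (fun x hx => PP_ne (hs x hx).2.1)
    hVU hVne hVopen hVconn.isPreconnected hcont hz
  refine ⟨c, hcV, fun x hx => ?_⟩
  have h1 : (PP g L x).map (aeval c) = 0 := by
    ext i j
    exact hcU x hx i j
  rw [PP_aeval] at h1
  have hhg : ((g x)⁻¹).map (algebraMap ℝ ℂ) * (g x).map (algebraMap ℝ ℂ) = 1 := by
    rw [← Matrix.map_mul, Matrix.nonsing_inv_mul _ (hs x hx).2.1]
    ext i j
    by_cases hij : i = j
    · subst hij; simp
    · simp [hij]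
  have h2 : (c • (1 : Matrix (Fin n) (Fin n) ℂ) - (L x).map (algebraMap ℝ ℂ)).adjugate = 0 := by
    have h5 := congrArg (fun M => ((g x)⁻¹).map (algebraMap ℝ ℂ) * M) h1
    rwa [← Matrix.mul_assoc, hhg, Matrix.one_mul, Matrix.mul_zero] at h5
  have h3 := adj_neg_zero h2
  rw [neg_sub] at h3
  have h4 := ker_of_adj_zero hn _ h3
  exact ⟨mem_spec_of_ker _ c h4, h4⟩
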